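/- arXiv:0910.0456 — 4 statements merged into one kernel-verified Lean document; each statement's English description precedes it below -/
import Mathlib

section
/- Consider the observational model y = X_T β_T + ε in ℝ^n, where T ⊂ {1,…,p} is the true sparsity pattern with |T| = k, X ∈ ℝ^{n×p} is a fixed perturbation matrix, β_T ∈ ℝ^k, and ε ∼ N(0, I_n). For any candidate sparsity pattern F ⊂ {1,…,p} with |F| = k and F ≠ T, such that X_F has full column rank, the probability (over ε) that the optimal decoder prefers F to T, i.e. Pr[ ‖y − Π_F y‖² < ‖y − Π_T y‖² ], is bounded above by exp( −c · ‖(I − Π_F) X_{T−F} β_{T−F}‖² + d/2 ), where c = (3 − 2√2)/2, d = |T − F| is the number of indices in T but not in F, and Π_F = X_F (X_Fᵀ X_F)^{−1} X_Fᵀ is the orthogonal projection onto the column space of X_F. -/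
open MeasureTheory ProbabilityTheory Matrix

noncomputable section

/-- The submatrix of `X` consisting of the columns indexed by `F`. -/
def colSub {n p : ℕ} (X : Matrix (Fin n) (Fin p) ℝ) (F : Finset (Fin p)) :
    Matrix (Fin n) {j // j ∈ F} ℝ :=
  X.submatrix id (fun j => (j : Fin p))

/-- `Π_F = X_F (X_Fᵀ X_F)⁻¹ X_Fᵀ`, the orthogonal projection onto the column
space of `X_F` (when `X_F` has full column rank). -/
def proj {n p : ℕ} (X : Matrix (Fin n) (Fin p) ℝ) (F : Finset (Fin p)) :
    Matrix (Fin n) (Fin n) ℝ :=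
  colSub X F * ((colSub X F)ᵀ * colSub X F)⁻¹ * (colSub X F)ᵀ

/-- The vector `β` with all entries outside `S` replaced by `0`; thus
`X.mulVec (restr β S) = X_S β_S`. -/
def restr {p : ℕ} (β : Fin p → ℝ) (S : Finset (Fin p)) : Fin p → ℝ :=
  fun i => if i ∈ S then β i else 0

/-- Squared Euclidean norm. -/
def sqnorm {n : ℕ} (v : Fin n → ℝ) : ℝ := ∑ i, (v i) ^ 2

/-- The law of a standard Gaussian vector `ε ∼ N(0, I_n)` on `ℝ^n`. -/
def stdGaussian (n : ℕ) : Measure (Fin n → ℝ) :=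
  Measure.pi fun _ => gaussianReal 0 1

/-- The exponential moments of the square of a shifted standard Gaussian variable. -/
lemma lintegral_exp_mul_sq_gaussianReal {s : ℝ} (hs : 2 * s < 1) (a : ℝ) :
    ∫⁻ z, ENNReal.ofReal (Real.exp (s * (a + z) ^ 2)) ∂gaussianReal 0 1 =
      ENNReal.ofReal (Real.sqrt (1 / (1 - 2 * s)) * Real.exp (s / (1 - 2 * s) * a ^ 2)) := by
  have h1 : 0 < 1 - 2 * s := by linarith
  set v : NNReal := ⟨1 / (1 - 2 * s), by positivity⟩ with hv
  have hvr : (v : ℝ) = 1 / (1 - 2 * s) := rfl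
  have hv0 : v ≠ 0 := by
    intro h
    have : (v : ℝ) = 0 := by rw [h]; rfl
    rw [hvr] at this
    exact absurd this (by positivity)
  rw [gaussianReal_of_var_ne_zero 0 one_ne_zero,
    lintegral_withDensity_eq_lintegral_mul _ (measurable_gaussianPDF 0 1) (by fun_prop)]
  have key : ∀ z, (gaussianPDF 0 1 * fun z => ENNReal.ofReal (Real.exp (s * (a + z) ^ 2))) z =
      ENNReal.ofReal (Real.sqrt (1 / (1 - 2 * s)) * Real.exp (s / (1 - 2 * s) * a ^ 2)) *
        ENNReal.ofReal (gaussianPDFReal (2 * s * a / (1 - 2 * s)) v z) := by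
    intro z
    rw [Pi.mul_apply, gaussianPDF, ← ENNReal.ofReal_mul (gaussianPDFReal_nonneg _ _ _),
      ← ENNReal.ofReal_mul (by positivity)]
    congr 1
    simp only [gaussianPDFReal, hvr]
    rw [Real.sqrt_mul (by positivity) (1 / (1 - 2 * s)), mul_assoc, ← Real.exp_add, mul_inv]
    have hsq : Real.sqrt (1 / (1 - 2 * s)) ≠ 0 := by positivity
    have hexp : -(z - 0) ^ 2 / (2 * ((1 : NNReal) : ℝ)) + s * (a + z) ^ 2 =
        s / (1 - 2 * s) * a ^ 2 +
          -(z - 2 * s * a / (1 - 2 * s)) ^ 2 / (2 * (1 / (1 - 2 * s))) := by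
      push_cast
      field_simp
      ring
    rw [hexp, Real.exp_add]
    push_cast
    field_simp
  simp_rw [key]
  rw [lintegral_const_mul _ (by fun_prop), lintegral_gaussianPDFReal_eq_one _ hv0, mul_one]

lemma lintegral_exp_mul_sq_gaussianReal_le {t l : ℝ} (ht : 0 ≤ t) (ht' : 2 * t < 1) (hl : l ≤ 1)
    (a : ℝ) :
    ∫⁻ z, ENNReal.ofReal (Real.exp (t * l * (a + z) ^ 2)) ∂gaussianReal 0 1 ≤
      ENNReal.ofReal
        (Real.exp ((t * l + 2 * t ^ 2 / (1 - 2 * t) * l ^ 2) * (a ^ 2 + 1))) := by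
  have htl : t * l ≤ t := mul_le_of_le_one_right ht hl
  have h1 : 0 < 1 - 2 * (t * l) := by linarith
  have h2 : 0 < 1 - 2 * t := by linarith
  rw [lintegral_exp_mul_sq_gaussianReal (by linarith)]
  refine ENNReal.ofReal_le_ofReal ?_
  have hsqrt : Real.sqrt (1 / (1 - 2 * (t * l))) ≤ Real.exp (t * l / (1 - 2 * (t * l))) := by
    rw [Real.sqrt_le_left (Real.exp_pos _).le, ← Real.exp_nat_mul]
    refine le_trans (le_of_eq ?_) (Real.add_one_le_exp _)
    have h1' := h1.ne'
    generalize t * l = q at h1'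
    push_cast
    field_simp
    ring
  have hcoef : t * l / (1 - 2 * (t * l)) ≤ t * l + 2 * t ^ 2 / (1 - 2 * t) * l ^ 2 := by
    have e : t * l / (1 - 2 * (t * l)) = t * l + 2 * (t * l) ^ 2 / (1 - 2 * (t * l)) := by
      rw [div_eq_iff h1.ne', add_mul, div_mul_cancel₀ _ h1.ne']
      ring
    have e' : 2 * t ^ 2 / (1 - 2 * t) * l ^ 2 = 2 * (t * l) ^ 2 / (1 - 2 * t) := by ring
    rw [e, e']
    gcongr
  calc _ ≤ Real.exp (t * l / (1 - 2 * (t * l))) *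
        Real.exp (t * l / (1 - 2 * (t * l)) * a ^ 2) := by gcongr
    _ = Real.exp (t * l / (1 - 2 * (t * l)) * (a ^ 2 + 1)) := by
        rw [← Real.exp_add]; ring_nf
    _ ≤ _ := by gcongr

/-- The standard Gaussian measure is the law of a random vector whose coordinates in any given
orthonormal basis are independent standard Gaussian. -/
lemma lintegral_stdGaussian_eq {n : ℕ}
    (b : OrthonormalBasis (Fin n) ℝ (EuclideanSpace ℝ (Fin n)))
    {f : EuclideanSpace ℝ (Fin n) → ENNReal} (hf : Measurable f) :
    ∫⁻ x, f (WithLp.toLp 2 x) ∂(Measure.pi fun _ : Fin n => gaussianReal 0 1) =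
      ∫⁻ z, f (∑ i, z i • b i) ∂(Measure.pi fun _ : Fin n => gaussianReal 0 1) := by
  have h := (map_pi_eq_stdGaussian (ι := Fin n)).trans (stdGaussian_eq_map_pi_orthonormalBasis b)
  rw [← lintegral_map hf (by fun_prop), h, lintegral_map hf (by fun_prop)]

lemma dotProduct_eq_sum_inner_mul_inner {n : ℕ}
    (b : OrthonormalBasis (Fin n) ℝ (EuclideanSpace ℝ (Fin n)))
    (v w : Fin n → ℝ) :
    v ⬝ᵥ w = ∑ i, inner ℝ (b i) (WithLp.toLp 2 v) * inner ℝ (b i) (WithLp.toLp 2 w) := by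
  have h := b.sum_inner_mul_inner (WithLp.toLp 2 v) (WithLp.toLp 2 w)
  simp only [real_inner_comm (b _) (WithLp.toLp 2 v)] at h
  rw [h, EuclideanSpace.inner_eq_star_dotProduct, dotProduct_comm]
  simp

namespace Matrix.IsHermitian

variable {n : ℕ} {A : Matrix (Fin n) (Fin n) ℝ} (hA : A.IsHermitian)

lemma inner_eigenvectorBasis_mulVec (v : Fin n → ℝ) (i : Fin n) :
    inner ℝ (hA.eigenvectorBasis i) (WithLp.toLp 2 (A *ᵥ v)) =
      hA.eigenvalues i * inner ℝ (hA.eigenvectorBasis i) (WithLp.toLp 2 v) := by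
  have hAt : Aᵀ = A := by simpa [IsHermitian] using hA
  simp only [EuclideanSpace.inner_eq_star_dotProduct, star_trivial]
  rw [dotProduct_comm, dotProduct_mulVec, ← mulVec_transpose, hAt, hA.mulVec_eigenvectorBasis,
    smul_dotProduct, smul_eq_mul, dotProduct_comm]

lemma dotProduct_mulVec_eq_sum (v : Fin n → ℝ) :
    v ⬝ᵥ A *ᵥ v =
      ∑ i, hA.eigenvalues i * inner ℝ (hA.eigenvectorBasis i) (WithLp.toLp 2 v) ^ 2 := by
  rw [dotProduct_eq_sum_inner_mul_inner hA.eigenvectorBasis]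
  refine Finset.sum_congr rfl fun i _ => ?_
  rw [hA.inner_eigenvectorBasis_mulVec]
  ring

lemma dotProduct_mul_self_mulVec_eq_sum (v : Fin n → ℝ) :
    v ⬝ᵥ (A * A) *ᵥ v =
      ∑ i, hA.eigenvalues i ^ 2 * inner ℝ (hA.eigenvectorBasis i) (WithLp.toLp 2 v) ^ 2 := by
  rw [dotProduct_eq_sum_inner_mul_inner hA.eigenvectorBasis, ← mulVec_mulVec]
  refine Finset.sum_congr rfl fun i _ => ?_
  rw [hA.inner_eigenvectorBasis_mulVec, hA.inner_eigenvectorBasis_mulVec]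
  ring

lemma trace_mul_self_eq_sum_eigenvalues_sq :
    (A * A).trace = ∑ i, hA.eigenvalues i ^ 2 := by
  conv_lhs => rw [hA.spectral_theorem, ← map_mul, Unitary.conjStarAlgAut_apply,
    trace_mul_comm, ← mul_assoc]
  simp [diagonal_mul_diagonal, trace_diagonal, pow_two]

lemma eigenvalues_le_one (h : ∀ v, v ⬝ᵥ A *ᵥ v ≤ v ⬝ᵥ v) (i : Fin n) : hA.eigenvalues i ≤ 1 := by
  have h' := h (hA.eigenvectorBasis i)
  have h1 : ((hA.eigenvectorBasis i : EuclideanSpace ℝ (Fin n)) : Fin n → ℝ) ⬝ᵥ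
      (hA.eigenvectorBasis i : EuclideanSpace ℝ (Fin n)) = 1 := by
    have := real_inner_self_eq_norm_sq (hA.eigenvectorBasis i)
    rw [hA.eigenvectorBasis.norm_eq_one, EuclideanSpace.inner_eq_star_dotProduct] at this
    simpa using this
  rwa [hA.mulVec_eigenvectorBasis, dotProduct_smul, h1, smul_eq_mul, mul_one] at h'

end Matrix.IsHermitian

/-- A bound for the exponential moments of a Gaussian quadratic form whose matrix is at most the
identity. -/
lemma lintegral_exp_quadratic_form_le {n : ℕ} {A : Matrix (Fin n) (Fin n) ℝ} (hA : A.IsHermitian)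
    (hA1 : ∀ v, v ⬝ᵥ A *ᵥ v ≤ v ⬝ᵥ v) {t : ℝ} (ht : 0 ≤ t) (ht' : 2 * t < 1) (m : Fin n → ℝ) :
    ∫⁻ x, ENNReal.ofReal (Real.exp (t * ((m + x) ⬝ᵥ A *ᵥ (m + x))))
        ∂(Measure.pi fun _ : Fin n => gaussianReal 0 1) ≤
      ENNReal.ofReal (Real.exp (t * (m ⬝ᵥ A *ᵥ m + A.trace) +
        2 * t ^ 2 / (1 - 2 * t) * (m ⬝ᵥ (A * A) *ᵥ m + (A * A).trace))) := by
  set b := hA.eigenvectorBasis with hb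
  set l := hA.eigenvalues with hl
  set a : Fin n → ℝ := fun i => inner ℝ (b i) (WithLp.toLp 2 m) with ha
  have hrot := lintegral_stdGaussian_eq b (f := fun u => ENNReal.ofReal (Real.exp
    (∑ i, t * l i * (a i + inner ℝ (b i) u) ^ 2))) (by fun_prop)
  have hquad : ∀ x : Fin n → ℝ, t * ((m + x) ⬝ᵥ A *ᵥ (m + x)) =
      ∑ i, t * l i * (a i + inner ℝ (b i) (WithLp.toLp 2 x)) ^ 2 := by
    intro x
    rw [hA.dotProduct_mulVec_eq_sum, Finset.mul_sum]
    refine Finset.sum_congr rfl fun i _ => ?_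
    rw [WithLp.toLp_add, inner_add_right, mul_assoc]
  simp_rw [hquad]
  rw [hrot]
  have hcoord : ∀ (z : Fin n → ℝ) i, inner ℝ (b i) (∑ j, z j • b j) = z i := fun z i => by
    simpa using b.orthonormal.inner_right_fintype z i
  simp_rw [hcoord, Real.exp_sum, ENNReal.ofReal_prod_of_nonneg fun i _ => (Real.exp_pos _).le]
  rw [lintegral_prod_eq_prod_lintegral_of_indepFun Finset.univ
    (fun i (z : Fin n → ℝ) => ENNReal.ofReal (Real.exp (t * l i * (a i + z i) ^ 2)))
    (iIndepFun_pi (X := fun i z => ENNReal.ofReal (Real.exp (t * l i * (a i + z) ^ 2)))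
      fun i => by fun_prop) (fun i => by fun_prop)]
  have heval : ∀ i, ∫⁻ z : Fin n → ℝ, ENNReal.ofReal (Real.exp (t * l i * (a i + z i) ^ 2))
      ∂(Measure.pi fun _ : Fin n => gaussianReal 0 1) =
      ∫⁻ z, ENNReal.ofReal (Real.exp (t * l i * (a i + z) ^ 2)) ∂gaussianReal 0 1 := fun i =>
    (measurePreserving_eval (fun _ : Fin n => gaussianReal 0 1) i).lintegral_comp
      (f := fun z => ENNReal.ofReal (Real.exp (t * l i * (a i + z) ^ 2))) (by fun_prop)
  simp_rw [heval]
  refine (Finset.prod_le_prod' fun i _ => lintegral_exp_mul_sq_gaussianReal_le ht ht'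
    (hA.eigenvalues_le_one hA1 i) (a i)).trans (le_of_eq ?_)
  rw [← ENNReal.ofReal_prod_of_nonneg fun i _ => (Real.exp_pos _).le, ← Real.exp_sum,
    hA.dotProduct_mulVec_eq_sum, hA.dotProduct_mul_self_mulVec_eq_sum,
    hA.trace_mul_self_eq_sum_eigenvalues_sq, hA.trace_eq_sum_eigenvalues]
  congr 2
  simp only [RCLike.ofReal_real_eq_id, id, ← Finset.sum_add_distrib, Finset.mul_sum]
  refine Finset.sum_congr rfl fun i _ => ?_
  ring

lemma linearIndependent_col_of_rank_eq_card {m ι : Type*} [Fintype m] [Fintype ι]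
    {M : Matrix m ι ℝ} (h : M.rank = Fintype.card ι) : LinearIndependent ℝ M.col := by
  rw [linearIndependent_iff_card_eq_finrank_span, Set.finrank, ← rank_eq_finrank_span_cols, h]

lemma isUnit_det_transpose_mul_self {m ι : Type*} [Fintype m] [Fintype ι] [DecidableEq ι]
    {M : Matrix m ι ℝ} (h : LinearIndependent ℝ M.col) : IsUnit (Mᵀ * M).det := by
  rw [← isUnit_iff_isUnit_det, ← mulVec_injective_iff_isUnit]
  rw [← mulVec_injective_iff] at h
  have h1 : LinearMap.ker M.mulVecLin = ⊥ := LinearMap.ker_eq_bot.mpr h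
  rw [← ker_mulVecLin_transpose_mul_self] at h1
  exact LinearMap.ker_eq_bot.mp h1

section Projections

variable {n p : ℕ} {X : Matrix (Fin n) (Fin p) ℝ} {F G : Finset (Fin p)}

lemma linearIndependent_colSub_mono (hGF : G ⊆ F) (h : LinearIndependent ℝ (colSub X F).col) :
    LinearIndependent ℝ (colSub X G).col :=
  h.comp (fun j : {j // j ∈ G} => (⟨j, hGF j.2⟩ : {j // j ∈ F}))
    fun _ _ hij => Subtype.ext (congrArg (fun x : {j // j ∈ F} => (x : Fin p)) hij)

variable (X) in
lemma transpose_proj (F : Finset (Fin p)) : (proj X F)ᵀ = proj X F := by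
  simp [proj, transpose_nonsing_inv, Matrix.mul_assoc]

lemma proj_mul_colSub (h : LinearIndependent ℝ (colSub X F).col) :
    proj X F * colSub X F = colSub X F := by
  rw [proj, Matrix.mul_assoc, Matrix.mul_assoc, nonsing_inv_mul _ (isUnit_det_transpose_mul_self h),
    Matrix.mul_one]

lemma proj_mulVec_mulVec_of_support_subset (h : LinearIndependent ℝ (colSub X F).col)
    {β : Fin p → ℝ} (hβ : ∀ i ∉ F, β i = 0) : proj X F *ᵥ (X *ᵥ β) = X *ᵥ β := by
  have hX : X *ᵥ β = colSub X F *ᵥ fun j => β j := by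
    ext i
    simp only [mulVec, dotProduct, colSub, submatrix_apply, id]
    rw [Finset.sum_coe_sort F fun j => X i j * β j]
    refine (Finset.sum_subset (Finset.subset_univ _) fun j _ hj => ?_).symm
    rw [hβ j hj, mul_zero]
  rw [hX, mulVec_mulVec, proj_mul_colSub h]

lemma proj_mul_proj_of_subset (hGF : G ⊆ F) (h : LinearIndependent ℝ (colSub X F).col) :
    proj X F * proj X G = proj X G := by
  have hcol : proj X F * colSub X G = colSub X G := by
    ext i j
    exact congrFun (congrFun (proj_mul_colSub h) i) (⟨j, hGF j.2⟩ : {j // j ∈ F})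
  rw [proj, proj, ← Matrix.mul_assoc, ← Matrix.mul_assoc, ← proj, hcol]

lemma proj_mul_proj_of_subset' (hGF : G ⊆ F) (h : LinearIndependent ℝ (colSub X F).col) :
    proj X G * proj X F = proj X G := by
  have := congrArg transpose (proj_mul_proj_of_subset hGF h)
  rwa [transpose_mul, transpose_proj, transpose_proj] at this

lemma trace_proj (h : LinearIndependent ℝ (colSub X F).col) : (proj X F).trace = F.card := by
  rw [proj, trace_mul_comm, ← Matrix.mul_assoc, mul_nonsing_inv _ (isUnit_det_transpose_mul_self h),
    trace_one, Fintype.card_coe]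

lemma dotProduct_mulVec_eq_of_isProj {P : Matrix (Fin n) (Fin n) ℝ} (hP : Pᵀ = P) (hPP : P * P = P)
    (v : Fin n → ℝ) : v ⬝ᵥ P *ᵥ v = (P *ᵥ v) ⬝ᵥ (P *ᵥ v) := by
  conv_lhs => rw [← hPP, ← mulVec_mulVec, dotProduct_mulVec, ← mulVec_transpose, hP]

lemma dotProduct_self_sub_mulVec {P : Matrix (Fin n) (Fin n) ℝ} (hP : Pᵀ = P) (hPP : P * P = P)
    (v : Fin n → ℝ) : (v - P *ᵥ v) ⬝ᵥ (v - P *ᵥ v) = v ⬝ᵥ v - v ⬝ᵥ P *ᵥ v := by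
  rw [sub_dotProduct, dotProduct_sub, dotProduct_sub, ← dotProduct_mulVec_eq_of_isProj hP hPP,
    dotProduct_comm (P *ᵥ v) v]
  ring

/-- The trace of the product of two projections is at least the dimension spanned by the common
columns. -/
lemma card_inter_le_trace_proj_mul_proj (hF : LinearIndependent ℝ (colSub X F).col)
    (hG : LinearIndependent ℝ (colSub X G).col) :
    ((F ∩ G).card : ℝ) ≤ (proj X F * proj X G).trace := by
  have hIF : F ∩ G ⊆ F := Finset.inter_subset_left
  have hIG : F ∩ G ⊆ G := Finset.inter_subset_right
  have hI := linearIndependent_colSub_mono hIF hF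
  rw [← trace_proj hI]
  set Q := proj X F - proj X (F ∩ G) with hQ
  have hQt : Qᵀ = Q := by rw [hQ, transpose_sub, transpose_proj, transpose_proj]
  have hQQ : Q * Q = Q := by
    rw [hQ, sub_mul, mul_sub, mul_sub, proj_mul_proj_of_subset subset_rfl hF,
      proj_mul_proj_of_subset hIF hF, proj_mul_proj_of_subset' hIF hF,
      proj_mul_proj_of_subset subset_rfl hI]
    abel
  have h0 : 0 ≤ ((proj X G * Q)ᵀ * (proj X G * Q)).trace :=
    Finset.sum_nonneg fun i _ => dotProduct_self_star_nonneg fun j => (proj X G * Q) j i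
  have h1 : ((proj X G * Q)ᵀ * (proj X G * Q)).trace = (Q * proj X G).trace := by
    rw [transpose_mul, hQt, transpose_proj, Matrix.mul_assoc, ← Matrix.mul_assoc (proj X G),
      proj_mul_proj_of_subset subset_rfl hG, trace_mul_comm, Matrix.mul_assoc, hQQ, trace_mul_comm]
  rw [h1, hQ, sub_mul, proj_mul_proj_of_subset' hIG hG, trace_sub] at h0
  linarith

end Projections

lemma sqnorm_eq_dotProduct {n : ℕ} (v : Fin n → ℝ) : sqnorm v = v ⬝ᵥ v := by
  simp [sqnorm, dotProduct, pow_two]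

lemma measure_pos_le_lintegral_exp {Ω : Type*} [MeasurableSpace Ω] (μ : Measure Ω) {f : Ω → ℝ}
    {t : ℝ} (hf : AEMeasurable (fun x => ENNReal.ofReal (Real.exp (t * f x))) μ) (ht : 0 ≤ t) :
    μ {x | 0 < f x} ≤ ∫⁻ x, ENNReal.ofReal (Real.exp (t * f x)) ∂μ := by
  refine (measure_mono fun x (hx : 0 < f x) => ?_).trans (meas_le_lintegral₀ hf fun _ h => h)
  exact ENNReal.one_le_ofReal.mpr (Real.one_le_exp (mul_nonneg ht hx.le))

/-- For the model `y = X_T β_T + ε` with `ε ∼ N(0, I_n)`,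
and any size-`k` pattern `F ≠ T` with `X_F` of full column rank, the
probability that the optimal decoder prefers `F` to the true pattern `T` is
at most `exp(-c ‖(I - Π_F) X_{T∖F} β_{T∖F}‖² + d/2)` where
`c = (3 - 2√2)/2` and `d = |T ∖ F|`. -/
theorem optimal_decoder_pairwise_error_bound {n p k : ℕ}
    (X : Matrix (Fin n) (Fin p) ℝ) (T F : Finset (Fin p))
    (hT : T.card = k) (hF : F.card = k) (hFT : F ≠ T)
    (hrF : (colSub X F).rank = k) (hrT : (colSub X T).rank = k)
    (β : Fin p → ℝ) (hβ : ∀ i ∉ T, β i = 0) :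
    stdGaussian n
      {ε | sqnorm (X.mulVec β + ε - (proj X F).mulVec (X.mulVec β + ε)) <
           sqnorm (X.mulVec β + ε - (proj X T).mulVec (X.mulVec β + ε))} ≤
    ENNReal.ofReal
      (Real.exp (-((3 - 2 * Real.sqrt 2) / 2) *
          sqnorm ((1 - proj X F).mulVec (X.mulVec (restr β (T \ F)))) +
        ((T \ F).card : ℝ) / 2)) := by
  have hliF : LinearIndependent ℝ (colSub X F).col :=
    linearIndependent_col_of_rank_eq_card (by rw [hrF, Fintype.card_coe, hF])
  have hliT : LinearIndependent ℝ (colSub X T).col :=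
    linearIndependent_col_of_rank_eq_card (by rw [hrT, Fintype.card_coe, hT])
  have hFF := proj_mul_proj_of_subset subset_rfl hliF
  have hTT := proj_mul_proj_of_subset subset_rfl hliT
  have hFt := transpose_proj X F
  have hTt := transpose_proj X T
  set m := X *ᵥ β with hm
  have hTm : proj X T *ᵥ m = m := proj_mulVec_mulVec_of_support_subset hliT hβ
  have hrestr : (1 - proj X F) *ᵥ (X *ᵥ restr β (T \ F)) = m - proj X F *ᵥ m := by
    have hsplit : m = X *ᵥ restr β (T \ F) + X *ᵥ restr β F := by
      rw [hm, ← mulVec_add]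
      congr 1
      ext i
      by_cases hiF : i ∈ F <;> by_cases hiT : i ∈ T <;> simp [restr, hiF, hiT, hβ]
    have hFr : proj X F *ᵥ (X *ᵥ restr β F) = X *ᵥ restr β F :=
      proj_mulVec_mulVec_of_support_subset hliF fun i hi => by simp [restr, hi]
    rw [hsplit, mulVec_add, hFr, sub_mulVec, one_mulVec]
    abel
  set A := proj X F - proj X T with hA
  have hAh : A.IsHermitian := by
    rw [IsHermitian, conjTranspose_eq_transpose_of_trivial, hA, transpose_sub, hFt, hTt]
  have hA1 : ∀ v, v ⬝ᵥ A *ᵥ v ≤ v ⬝ᵥ v := fun v => by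
    have h1 := dotProduct_self_star_nonneg (v - proj X F *ᵥ v)
    have h2 := dotProduct_self_star_nonneg (proj X T *ᵥ v)
    rw [star_trivial, dotProduct_self_sub_mulVec hFt hFF] at h1
    rw [star_trivial, ← dotProduct_mulVec_eq_of_isProj hTt hTT] at h2
    rw [hA, sub_mulVec, dotProduct_sub]
    linarith
  have hAm : m ⬝ᵥ A *ᵥ m = -sqnorm (m - proj X F *ᵥ m) := by
    rw [sqnorm_eq_dotProduct, dotProduct_self_sub_mulVec hFt hFF, hA, sub_mulVec, dotProduct_sub,
      hTm]
    ring
  have hAAm : m ⬝ᵥ (A * A) *ᵥ m = sqnorm (m - proj X F *ᵥ m) := by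
    have hAv : A *ᵥ m = -(m - proj X F *ᵥ m) := by rw [hA, sub_mulVec, hTm]; abel
    have hAt : Aᵀ = A := by rw [hA, transpose_sub, hFt, hTt]
    rw [← mulVec_mulVec, dotProduct_mulVec, ← mulVec_transpose, hAt, hAv, neg_dotProduct_neg,
      sqnorm_eq_dotProduct]
  have htr : A.trace = 0 := by
    rw [hA, trace_sub, trace_proj hliF, trace_proj hliT, hF, hT, sub_self]
  have htr2 : (A * A).trace ≤ 2 * ((T \ F).card : ℝ) := by
    have hle := card_inter_le_trace_proj_mul_proj hliF hliT
    have hcard : ((T \ F).card : ℝ) + (F ∩ T).card = k := by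
      rw [← hT, Finset.inter_comm]
      exact_mod_cast Finset.card_sdiff_add_card_inter T F
    rw [hA, sub_mul, mul_sub, mul_sub, hFF, hTT, trace_sub, trace_sub, trace_sub, trace_proj hliF,
      trace_proj hliT, trace_mul_comm (proj X T), hF, hT]
    linarith
  have hs0 : 0 < Real.sqrt 2 := by positivity
  have hss : Real.sqrt 2 ^ 2 = 2 := Real.sq_sqrt zero_le_two
  have hs2 : 3 * Real.sqrt 2 ≤ 5 := by nlinarith
  set t : ℝ := (2 - Real.sqrt 2) / 4 with ht
  have ht0 : 0 ≤ t := by rw [ht]; linarith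
  have ht1 : 2 * t < 1 := by rw [ht]; linarith
  have hr : 2 * t ^ 2 / (1 - 2 * t) = (3 * Real.sqrt 2 - 4) / 4 := by
    rw [div_eq_iff (by linarith), ht]
    linear_combination (-1 / 4) * hss
  have hevent : ∀ ε : Fin n → ℝ, sqnorm (m + ε - proj X F *ᵥ (m + ε)) <
      sqnorm (m + ε - proj X T *ᵥ (m + ε)) ↔ 0 < (m + ε) ⬝ᵥ A *ᵥ (m + ε) := fun ε => by
    rw [sqnorm_eq_dotProduct, sqnorm_eq_dotProduct, dotProduct_self_sub_mulVec hFt hFF,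
      dotProduct_self_sub_mulVec hTt hTT, hA, sub_mulVec, dotProduct_sub]
    constructor <;> intro h <;> linarith
  simp_rw [hevent]
  rw [hrestr]
  have hmeas : Continuous fun ε : Fin n → ℝ => (m + ε) ⬝ᵥ A *ᵥ (m + ε) := by fun_prop
  refine (measure_pos_le_lintegral_exp _ (t := t) (by fun_prop) ht0).trans
    ((lintegral_exp_quadratic_form_le hAh hA1 ht0 ht1 m).trans ?_)
  refine ENNReal.ofReal_le_ofReal (Real.exp_le_exp.mpr ?_)
  rw [hAm, hAAm, htr, hr]
  have hd : (0 : ℝ) ≤ (T \ F).card := Nat.cast_nonneg _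
  have h4 : 0 ≤ (3 * Real.sqrt 2 - 4) / 4 := by nlinarith
  have htrace : (3 * Real.sqrt 2 - 4) / 4 * (A * A).trace ≤ ((T \ F).card : ℝ) / 2 := by
    have := mul_le_mul_of_nonneg_left htr2 h4
    nlinarith
  rw [ht]
  linarith

end
end

section
/- Let y ∼ N(μ, I_n) in ℝ^n, let Ψ ∈ ℝ^{n×n} be a symmetric matrix and t ∈ ℝ be such that I − 2tΨ is positive definite. Then log E[ exp(t · yᵀΨy) ] = 2t² · μᵀΨ(I − 2tΨ)^{−1}Ψμ + t · μᵀΨμ − (1/2) · log det(I − 2tΨ). -/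
open MeasureTheory ProbabilityTheory Matrix

noncomputable section

lemma integral_exp_sq_gaussianReal {l : ℝ} (hl : 0 < l) (a : ℝ) :
    ∫ z, Real.exp ((1 - l) / 2 * (a + z) ^ 2) ∂ gaussianReal 0 1 =
      (√l)⁻¹ * Real.exp ((1 - l) / (2 * l) * a ^ 2) := by
  rw [integral_gaussianReal_eq_integral_smul one_ne_zero]
  have h (z : ℝ) : gaussianPDFReal 0 1 z • Real.exp ((1 - l) / 2 * (a + z) ^ 2) =
      (√(2 * Real.pi))⁻¹ * Real.exp ((1 - l) / (2 * l) * a ^ 2) *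
        Real.exp (-(l / 2) * (z - (1 - l) * a / l) ^ 2) := by
    simp only [gaussianPDFReal, NNReal.coe_one, mul_one, sub_zero, smul_eq_mul]
    rw [mul_assoc, mul_assoc, ← Real.exp_add, ← Real.exp_add]
    congr 2
    field_simp
    ring
  simp_rw [h]
  rw [integral_const_mul, integral_sub_right_eq_self (fun z => Real.exp (-(l / 2) * z ^ 2)),
    integral_gaussian, show Real.pi / (l / 2) = 2 * Real.pi * l⁻¹ by field_simp,
    Real.sqrt_mul (x := 2 * Real.pi) (by positivity), Real.sqrt_inv]
  have : √(2 * Real.pi) ≠ 0 := by positivity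
  field_simp

/-- The standard Gaussian law on `ℝ^n` is invariant under orthogonal matrices. -/
lemma map_mulVec_stdGaussian {n : ℕ} (U : unitaryGroup (Fin n) ℝ) :
    (_root_.stdGaussian n).map ((U : Matrix (Fin n) (Fin n) ℝ) *ᵥ ·) = _root_.stdGaussian n := by
  let f : EuclideanSpace ℝ (Fin n) ≃ₗᵢ[ℝ] EuclideanSpace ℝ (Fin n) :=
    Unitary.linearIsometryEquiv
      ⟨toEuclideanCLM (n := Fin n) (𝕜 := ℝ) U, Unitary.map_mem toEuclideanCLM U.2⟩
  have hU : ((U : Matrix (Fin n) (Fin n) ℝ) *ᵥ ·) = WithLp.ofLp ∘ f ∘ WithLp.toLp 2 := by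
    ext x i
    rfl
  have hid : (_root_.stdGaussian n) =
      (ProbabilityTheory.stdGaussian (EuclideanSpace ℝ (Fin n))).map WithLp.ofLp := by
    rw [← map_pi_eq_stdGaussian, Measure.map_map (by fun_prop) (by fun_prop)]
    exact Measure.map_id.symm
  rw [hU, ← Measure.map_map (by fun_prop) (by fun_prop),
    ← Measure.map_map (by fun_prop) (by fun_prop), _root_.stdGaussian, map_pi_eq_stdGaussian,
    ProbabilityTheory.stdGaussian_map, ← hid, _root_.stdGaussian]

/-- The exponential moment of a shifted diagonal quadratic form in a standard Gaussian vector. -/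
lemma integral_exp_sum_sq_stdGaussian {n : ℕ} {l : Fin n → ℝ} (hl : ∀ i, 0 < l i)
    (a : Fin n → ℝ) :
    ∫ z, Real.exp (∑ i, (1 - l i) / 2 * (a i + z i) ^ 2) ∂ _root_.stdGaussian n =
      (√(∏ i, l i))⁻¹ * Real.exp (∑ i, (1 - l i) / (2 * l i) * a i ^ 2) := by
  simp_rw [Real.exp_sum, _root_.stdGaussian]
  rw [integral_fintype_prod_eq_prod (fun i z => Real.exp ((1 - l i) / 2 * (a i + z) ^ 2))]
  simp_rw [integral_exp_sq_gaussianReal (hl _)]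
  rw [Finset.prod_mul_distrib, Finset.prod_inv_distrib,
    Real.sqrt_prod _ fun i _ => (hl i).le]

lemma unitaryGroup_mulVec_dotProduct_mulVec {n : ℕ} (U : unitaryGroup (Fin n) ℝ)
    (x y : Fin n → ℝ) :
    ((U : Matrix (Fin n) (Fin n) ℝ) *ᵥ x) ⬝ᵥ ((U : Matrix (Fin n) (Fin n) ℝ) *ᵥ y) = x ⬝ᵥ y := by
  have h : (U : Matrix (Fin n) (Fin n) ℝ)ᵀ * U = 1 := by
    simpa [star_eq_conjTranspose] using Unitary.coe_star_mul_self U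
  rw [dotProduct_mulVec, ← mulVec_transpose, mulVec_mulVec, h, one_mulVec]

/-- For `y ∼ N(μ, I_n)`, a symmetric `Ψ` and `t` with
`I - 2tΨ` positive definite,
`log E[exp(t yᵀΨy)] = 2t² μᵀΨ(I - 2tΨ)⁻¹Ψμ + t μᵀΨμ - (1/2) log det(I - 2tΨ)`. -/
theorem log_mgf_gaussian_quadratic_form {n : ℕ} (μ : Fin n → ℝ)
    (Ψ : Matrix (Fin n) (Fin n) ℝ) (hΨ : Ψ.IsSymm) (t : ℝ)
    (hpd : (1 - (2 * t) • Ψ).PosDef) :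
    Real.log (∫ ε, Real.exp (t * ((μ + ε) ⬝ᵥ Ψ.mulVec (μ + ε))) ∂ stdGaussian n) =
      2 * t ^ 2 * (μ ⬝ᵥ Ψ.mulVec (((1 - (2 * t) • Ψ)⁻¹).mulVec (Ψ.mulVec μ))) +
        t * (μ ⬝ᵥ Ψ.mulVec μ) - 1 / 2 * Real.log (1 - (2 * t) • Ψ).det := by
  set M := 1 - (2 * t) • Ψ with hM
  let V := hpd.1.eigenvectorUnitary
  set U := (V : Matrix (Fin n) (Fin n) ℝ) with hU
  set l := hpd.1.eigenvalues
  have hpos (i : Fin n) : 0 < l i := hpd.eigenvalues_pos i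
  have hUU : U * star U = 1 := Unitary.coe_mul_star_self V
  have hUU' : star U * U = 1 := Unitary.coe_star_mul_self V
  have hMU : M * U = U * diagonal l := by
    have h : M = U * diagonal l * star U := by
      simpa [Unitary.conjStarAlgAut_apply] using hpd.1.spectral_theorem
    rw [h, mul_assoc, hUU', mul_one]
  have hinv : M⁻¹ * U = U * diagonal fun i => (l i)⁻¹ := by
    have hdet : IsUnit M.det := hpd.det_pos.ne'.isUnit
    have hdiag : diagonal l * diagonal (fun i => (l i)⁻¹) = 1 := by
      simp [diagonal_mul_diagonal, (hpos _).ne']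
    calc M⁻¹ * U = M⁻¹ * (M * U) * diagonal fun i => (l i)⁻¹ := by
          rw [hMU, mul_assoc, mul_assoc, hdiag, mul_one]
      _ = _ := by rw [nonsing_inv_mul_cancel_left _ _ hdet]
  have hΨU : (t • Ψ) * U = U * diagonal fun i => (1 - l i) / 2 := by
    have h1 : t • Ψ = (1 / 2 : ℝ) • (1 - M) := by
      rw [hM, sub_sub_cancel, smul_smul]
      congr 1
      ring
    have h2 : diagonal (fun i => (1 - l i) / 2) = (1 / 2 : ℝ) • (1 - diagonal l) := by
      rw [← diagonal_one, diagonal_sub, ← diagonal_smul]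
      congr 1
      ext i
      simp
      ring
    rw [h1, h2, smul_mul_assoc, sub_mul, hMU, mul_smul_comm, mul_sub, one_mul, mul_one]
  obtain ⟨a, rfl⟩ : ∃ a, μ = U *ᵥ a := ⟨star U *ᵥ μ, by rw [mulVec_mulVec, hUU, one_mulVec]⟩
  have hΨvec (w : Fin n → ℝ) :
      t • (Ψ *ᵥ (U *ᵥ w)) = U *ᵥ fun i => (1 - l i) / 2 * w i := by
    rw [← smul_mulVec, mulVec_mulVec, hΨU, ← mulVec_mulVec]
    congr 1
    ext i
    exact mulVec_diagonal _ _ _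
  have hinvvec (w : Fin n → ℝ) : M⁻¹ *ᵥ (U *ᵥ w) = U *ᵥ fun i => (l i)⁻¹ * w i := by
    rw [mulVec_mulVec, hinv, ← mulVec_mulVec]
    congr 1
    ext i
    exact mulVec_diagonal _ _ _
  have hquad (w : Fin n → ℝ) :
      t * ((U *ᵥ w) ⬝ᵥ Ψ *ᵥ (U *ᵥ w)) = ∑ i, (1 - l i) / 2 * w i ^ 2 := by
    rw [← smul_eq_mul, ← dotProduct_smul, hΨvec, unitaryGroup_mulVec_dotProduct_mulVec V]
    exact Finset.sum_congr rfl fun i _ => by ring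
  have hint : ∫ ε, Real.exp (t * ((U *ᵥ a + ε) ⬝ᵥ Ψ *ᵥ (U *ᵥ a + ε))) ∂ _root_.stdGaussian n =
      (√(∏ i, l i))⁻¹ * Real.exp (∑ i, (1 - l i) / (2 * l i) * a i ^ 2) := by
    rw [← integral_exp_sum_sq_stdGaussian hpos]
    conv_lhs => rw [← map_mulVec_stdGaussian V]
    rw [integral_map (by fun_prop) (by fun_prop)]
    simp_rw [← hU, ← mulVec_add, hquad, Pi.add_apply]
  have hsq : 2 * t ^ 2 * ((U *ᵥ a) ⬝ᵥ Ψ *ᵥ (M⁻¹ *ᵥ (Ψ *ᵥ (U *ᵥ a)))) =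
      ∑ i, 2 * ((1 - l i) / 2) ^ 2 * (l i)⁻¹ * a i ^ 2 := by
    calc _ = 2 * ((U *ᵥ a) ⬝ᵥ t • Ψ *ᵥ (M⁻¹ *ᵥ (t • Ψ *ᵥ (U *ᵥ a)))) := by
          simp only [mulVec_smul, dotProduct_smul, smul_eq_mul]
          ring
      _ = _ := by
          rw [hΨvec, hinvvec, hΨvec, unitaryGroup_mulVec_dotProduct_mulVec V, dotProduct,
            Finset.mul_sum]
          exact Finset.sum_congr rfl fun i _ => by ring
  have hprod : 0 < ∏ i, l i := Finset.prod_pos fun i _ => hpos i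
  have hdet : M.det = ∏ i, l i := by simpa using hpd.1.det_eq_prod_eigenvalues
  rw [hint, hsq, hquad, hdet, Real.log_mul (by positivity) (Real.exp_ne_zero _), Real.log_exp,
    Real.log_inv, Real.log_sqrt hprod.le, ← Finset.sum_add_distrib]
  have hsum : ∑ i, (1 - l i) / (2 * l i) * a i ^ 2 =
      ∑ i, (2 * ((1 - l i) / 2) ^ 2 * (l i)⁻¹ * a i ^ 2 + (1 - l i) / 2 * a i ^ 2) := by
    refine Finset.sum_congr rfl fun i _ => ?_
    have := (hpos i).ne'
    field_simp
    ring
  rw [hsum]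
  ring

end
end

section
/- Consider the model y = X_T β_T + ε in ℝ^n where the entries of X ∈ ℝ^{n×p} are i.i.d. N(0,1) and ε ∼ N(0, I_n) is independent of X, with true size-k sparsity pattern T. For any size-k pattern F ≠ T, the probability (over both X and ε) that the optimal decoder prefers F to T satisfies Pr[ ‖y − Π_F y‖² < ‖y − Π_T y‖² ] ≤ exp( −((n−k)/2) · log(1 + 2c·‖β_{T−F}‖²) + d/2 ), where d = |T − F| and c = (3 − 2√2)/2. -/
open MeasureTheory ProbabilityTheory Matrix

noncomputable section

/-- The joint law of an `n × p` matrix with i.i.d. `N(0,1)` entries and an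
independent standard Gaussian noise vector in `ℝ^n`. -/
def jointGaussian (n p : ℕ) : Measure ((Fin n → Fin p → ℝ) × (Fin n → ℝ)) :=
  (Measure.pi fun _ : Fin n => Measure.pi fun _ : Fin p => gaussianReal 0 1).prod
    (Measure.pi fun _ : Fin n => gaussianReal 0 1)

theorem lintegral_pi_prod {ι : Type*} [Fintype ι] (μ : ι → Measure ℝ)
    [∀ i, IsProbabilityMeasure (μ i)] (f : ι → ℝ → ENNReal) (hf : ∀ i, Measurable (f i)) :
    ∫⁻ x, ∏ i, f i (x i) ∂Measure.pi μ = ∏ i, ∫⁻ t, f i t ∂μ i := by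
  rw [lintegral_prod_eq_prod_lintegral_of_indepFun (μ := Measure.pi μ) Finset.univ
    (fun i (x : ι → ℝ) => f i (x i)) (iIndepFun_pi fun i => (hf i).aemeasurable)
    fun i => (hf i).comp (measurable_pi_apply i)]
  refine Finset.prod_congr rfl fun i _ => ?_
  exact (measurePreserving_eval μ i).lintegral_comp (hf i)

theorem map_dotProduct_pi_gaussianReal {ι : Type*} [Fintype ι] (β : ι → ℝ) :
    (Measure.pi fun _ : ι => gaussianReal 0 1).map (fun x => x ⬝ᵥ β) =
      gaussianReal 0 (∑ i, β i ^ 2).toNNReal := by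
  have hm : Measurable fun x : ι → ℝ => x ⬝ᵥ β := by
    unfold dotProduct; fun_prop
  have := Measure.isProbabilityMeasure_map (μ := Measure.pi fun _ : ι => gaussianReal 0 1)
    hm.aemeasurable
  refine Measure.ext_of_charFun (funext fun t => ?_)
  have h := charFun_pi (μ := fun _ : ι => gaussianReal 0 1) (WithLp.toLp 2 (t • β))
  rw [charFun_apply, ← MeasurableEquiv.coe_toLp, integral_map_equiv] at h
  rw [charFun_apply_real, integral_map hm.aemeasurable (by fun_prop)]
  simp only [charFun_gaussianReal, ← Complex.exp_sum] at h ⊢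
  convert h using 1
  · refine integral_congr_ae (.of_forall fun x => ?_)
    simp only [dotProduct, MeasurableEquiv.coe_toLp, PiLp.inner_apply, RCLike.inner_apply,
      conj_trivial, Pi.smul_apply, smul_eq_mul]
    push_cast
    congr 2
    rw [Finset.mul_sum]
    exact Finset.sum_congr rfl fun i _ => by ring
  · congr 1
    simp only [Real.coe_toNNReal _ (Finset.sum_nonneg fun i _ => sq_nonneg (β i))]
    simp [Finset.mul_sum, ← Finset.sum_div, mul_pow, mul_comm]

theorem map_mulVec_pi_gaussianReal {ι : Type*} [Fintype ι] [DecidableEq ι] (v : NNReal)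
    {U : Matrix ι ι ℝ} (hU : U * Uᵀ = 1) :
    (Measure.pi fun _ : ι => gaussianReal 0 v).map (fun x => U *ᵥ x) =
      Measure.pi fun _ : ι => gaussianReal 0 v := by
  have hm : Measurable fun x : ι → ℝ => U *ᵥ x := by
    unfold mulVec dotProduct; fun_prop
  have := Measure.isProbabilityMeasure_map (μ := Measure.pi fun _ : ι => gaussianReal 0 v)
    hm.aemeasurable
  rw [← charFun_eq_pi_iff]
  intro t
  have h := charFun_pi (μ := fun _ : ι => gaussianReal 0 v) (WithLp.toLp 2 (Uᵀ *ᵥ t))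
  rw [charFun_apply, ← MeasurableEquiv.coe_toLp, integral_map_equiv] at h ⊢
  rw [integral_map hm.aemeasurable (by fun_prop)]
  simp only [charFun_gaussianReal, ← Complex.exp_sum] at h ⊢
  convert h using 1
  · refine integral_congr_ae (.of_forall fun x => ?_)
    have : t.ofLp ⬝ᵥ U *ᵥ x = (Uᵀ *ᵥ t) ⬝ᵥ x := by
      rw [dotProduct_mulVec, mulVec_transpose]
    simpa [MeasurableEquiv.coe_toLp, PiLp.inner_apply, dotProduct] using
      congrArg (fun s : ℝ => Complex.exp (s * Complex.I)) this
  · have : t.ofLp ⬝ᵥ t.ofLp = (Uᵀ *ᵥ t) ⬝ᵥ (Uᵀ *ᵥ t) := by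
      rw [dotProduct_mulVec, vecMul_transpose, mulVec_mulVec, hU, one_mulVec]
    congr 1
    simp only [dotProduct] at this
    have h2 := congrArg (fun s : ℝ => -(v * s / 2 : ℂ)) this
    simpa [Finset.mul_sum, Finset.sum_div, pow_two] using h2

theorem lintegral_exp_linear_gaussianReal (c : ℝ) :
    ∫⁻ x, ENNReal.ofReal (Real.exp (c * x)) ∂gaussianReal 0 1 =
      ENNReal.ofReal (Real.exp (c ^ 2 / 2)) := by
  rw [← ofReal_integral_eq_lintegral_ofReal (integrable_exp_mul_gaussianReal c)
    (.of_forall fun x => (Real.exp_pos _).le)]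
  have := congrFun (mgf_fun_id_gaussianReal (μ := 0) (v := 1)) c
  simp only [mgf] at this
  rw [this]; simp

theorem lintegral_exp_sq_gaussianReal (v : NNReal) {a : ℝ} (ha : 2 * a * v < 1) :
    ∫⁻ x, ENNReal.ofReal (Real.exp (a * x ^ 2)) ∂gaussianReal 0 v =
      ENNReal.ofReal ((1 - 2 * a * v) ^ (-(1 / 2) : ℝ)) := by
  rcases eq_or_ne v 0 with rfl | hv
  · simp
  have hv' : (0 : ℝ) < v := by positivity
  have hb : 0 < (1 - 2 * a * v) / (2 * v) := by
    have : 0 < 1 - 2 * a * v := by linarith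
    positivity
  rw [gaussianReal_of_var_ne_zero _ hv, lintegral_withDensity_eq_lintegral_mul _
    (measurable_gaussianPDF _ _) (by fun_prop)]
  have key : ∀ x : ℝ, (gaussianPDF 0 v * fun x => ENNReal.ofReal (Real.exp (a * x ^ 2))) x =
      ENNReal.ofReal ((√(2 * Real.pi * v))⁻¹ *
        Real.exp (-((1 - 2 * a * v) / (2 * v)) * x ^ 2)) := by
    intro x
    simp only [Pi.mul_apply, gaussianPDF, gaussianPDFReal]
    rw [← ENNReal.ofReal_mul (by positivity), mul_assoc, ← Real.exp_add]
    congr 3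
    field_simp
    ring
  simp only [key]
  rw [← ofReal_integral_eq_lintegral_ofReal ((integrable_exp_neg_mul_sq hb).const_mul _)
    (.of_forall fun x => by positivity), integral_const_mul, integral_gaussian]
  congr 1
  have h1 : 0 < 1 - 2 * a * v := by linarith
  rw [Real.rpow_neg h1.le, ← Real.sqrt_eq_rpow, ← Real.sqrt_inv, ← Real.sqrt_mul (by positivity),
    ← Real.sqrt_inv]
  congr 1
  field_simp

theorem exists_simultaneous_diagonalization {ι : Type*} [Fintype ι] [DecidableEq ι]
    {P Q : Matrix ι ι ℝ} (hP : Pᵀ = P) (hPP : P * P = P) (hQ : Qᵀ = Q) (hQQ : Q * Q = Q)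
    (hPQ : P * Q = 0) :
    ∃ (U : Matrix ι ι ℝ) (p q : ι → ℝ), U * Uᵀ = 1 ∧ Uᵀ * P * U = diagonal p ∧
      Uᵀ * Q * U = diagonal q ∧ ∀ i, p i * p i = p i ∧ q i * q i = q i ∧ p i * q i = 0 := by
  have hQP : Q * P = 0 := by
    have := congrArg transpose hPQ
    rwa [transpose_mul, hP, hQ, transpose_zero] at this
  have hD : (P + (2 : ℝ) • Q).IsHermitian := by
    rw [IsHermitian, conjTranspose_eq_transpose_of_trivial, transpose_add, transpose_smul, hP, hQ]
  set D := P + (2 : ℝ) • Q with hDdef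
  set U : Matrix ι ι ℝ := hD.eigenvectorUnitary.1
  have hU1 : U * Uᵀ = 1 := by
    have := Unitary.coe_mul_star_self hD.eigenvectorUnitary
    rwa [Unitary.coe_star, star_eq_conjTranspose, conjTranspose_eq_transpose_of_trivial] at this
  have hU2 : Uᵀ * U = 1 := mul_eq_one_comm.mp hU1
  have hDD : Uᵀ * D * U = diagonal hD.eigenvalues := by
    have := hD.conjStarAlgAut_star_eigenvectorUnitary
    rw [Unitary.conjStarAlgAut_star_apply] at this
    rw [star_eq_conjTranspose, conjTranspose_eq_transpose_of_trivial] at this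
    simpa using this
  have hmul : ∀ A B : Matrix ι ι ℝ, Uᵀ * (A * B) * U = (Uᵀ * A * U) * (Uᵀ * B * U) := by
    intro A B
    calc Uᵀ * (A * B) * U = Uᵀ * A * 1 * B * U := by simp only [Matrix.mul_assoc, Matrix.one_mul]
      _ = _ := by rw [← hU1]; simp only [Matrix.mul_assoc]
  have hD2 : D * D = P + (4 : ℝ) • Q := by
    rw [hDdef]
    simp only [add_mul, mul_add, smul_mul_assoc, mul_smul_comm, hPP, hQQ, hPQ, hQP, smul_zero,
      add_zero, zero_add, smul_smul]
    norm_num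
  have hPD : P = (2 : ℝ) • D - D * D := by
    rw [hD2, hDdef, smul_add, smul_smul]; norm_num; rw [two_smul]; abel
  have hQD : Q = (1 / 2 : ℝ) • (D * D - D) := by
    rw [hD2, hDdef, add_sub_add_left_eq_sub, ← sub_smul, smul_smul]; norm_num
  have hPU : Uᵀ * P * U = diagonal fun i => 2 * hD.eigenvalues i -
      hD.eigenvalues i * hD.eigenvalues i := by
    rw [hPD, mul_sub, sub_mul, hmul, mul_smul_comm, smul_mul_assoc, hDD, diagonal_mul_diagonal,
      ← diagonal_smul, diagonal_sub]
    rfl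
  have hQU : Uᵀ * Q * U = diagonal fun i => 1 / 2 * (hD.eigenvalues i * hD.eigenvalues i -
      hD.eigenvalues i) := by
    rw [hQD, mul_smul_comm, smul_mul_assoc, mul_sub, sub_mul, hmul, hDD, diagonal_mul_diagonal,
      diagonal_sub, ← diagonal_smul]
    rfl
  refine ⟨U, _, _, hU1, hPU, hQU, fun i => ⟨?_, ?_, ?_⟩⟩
  · have := hmul P P
    rw [hPP, hPU, diagonal_mul_diagonal] at this
    exact (congrFun (diagonal_injective this) i).symm
  · have := hmul Q Q
    rw [hQQ, hQU, diagonal_mul_diagonal] at this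
    exact (congrFun (diagonal_injective this) i).symm
  · have := hmul P Q
    rw [hPQ, hPU, hQU, diagonal_mul_diagonal, mul_zero, zero_mul, ← diagonal_zero] at this
    exact (congrFun (diagonal_injective this) i).symm

theorem lintegral_exp_quadratic_real (v : NNReal) {p q : ℝ} (hp : p * p = p) (hq : q * q = q)
    (hpq : p * q = 0) :
    ∫⁻ w, ∫⁻ x, ENNReal.ofReal (Real.exp (1 / 4 * (p * x ^ 2 - q * w ^ 2 - 2 * (q * w * x))))
      ∂gaussianReal 0 1 ∂gaussianReal 0 v =
      ENNReal.ofReal ((2 : ℝ) ^ (p / 2) * (1 + v / 4 : ℝ) ^ (-(q / 2))) := by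
  have hp' : p = 0 ∨ p = 1 := by
    rcases mul_eq_zero.mp (show p * (p - 1) = 0 by linarith) with h | h
    · exact .inl h
    · exact .inr (by linarith)
  have hq' : q = 0 ∨ q = 1 := by
    rcases mul_eq_zero.mp (show q * (q - 1) = 0 by linarith) with h | h
    · exact .inl h
    · exact .inr (by linarith)
  rcases hp' with rfl | rfl <;> rcases hq' with rfl | rfl
  · simp
  · have h1 : ∀ w x : ℝ, ENNReal.ofReal
        (Real.exp (1 / 4 * (0 * x ^ 2 - 1 * w ^ 2 - 2 * (1 * w * x)))) =
        ENNReal.ofReal (Real.exp (-(1 / 4) * w ^ 2)) *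
          ENNReal.ofReal (Real.exp (-(w / 2) * x)) := by
      intro w x
      rw [← ENNReal.ofReal_mul (by positivity), ← Real.exp_add]
      congr 2; ring
    have h2 : ∀ w : ℝ, ENNReal.ofReal (Real.exp (-(1 / 4) * w ^ 2)) *
        ENNReal.ofReal (Real.exp ((-(w / 2)) ^ 2 / 2)) =
        ENNReal.ofReal (Real.exp (-(1 / 8) * w ^ 2)) := by
      intro w
      rw [← ENNReal.ofReal_mul (by positivity), ← Real.exp_add]
      congr 2; ring
    simp_rw [h1]
    conv_lhs =>
      enter [2, w]
      rw [lintegral_const_mul _ (by fun_prop), lintegral_exp_linear_gaussianReal, h2]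
    rw [lintegral_exp_sq_gaussianReal v (by have := v.2; linarith [show (0 : ℝ) ≤ v from this])]
    congr 1
    rw [zero_div, Real.rpow_zero, one_mul]
    congr 1; ring
  · have h1 : ∀ w x : ℝ, ENNReal.ofReal
        (Real.exp (1 / 4 * (1 * x ^ 2 - 0 * w ^ 2 - 2 * (0 * w * x)))) =
        ENNReal.ofReal (Real.exp ((1 / 4) * x ^ 2)) := by
      intro w x; congr 2; ring
    simp_rw [h1]
    rw [lintegral_const, measure_univ, mul_one, lintegral_exp_sq_gaussianReal 1 (by norm_num)]
    congr 1
    rw [zero_div, neg_zero, Real.rpow_zero, mul_one, Real.rpow_neg (by norm_num),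
      ← Real.inv_rpow (by norm_num)]
    norm_num
  · norm_num at hpq

theorem lintegral_exp_quadratic {ι : Type*} [Fintype ι] [DecidableEq ι] (v : NNReal)
    {P Q : Matrix ι ι ℝ} (hP : Pᵀ = P) (hPP : P * P = P) (hQ : Qᵀ = Q) (hQQ : Q * Q = Q)
    (hPQ : P * Q = 0) :
    ∫⁻ w, ∫⁻ x, ENNReal.ofReal (Real.exp (1 / 4 *
        (x ⬝ᵥ P *ᵥ x - w ⬝ᵥ Q *ᵥ w - 2 * (w ⬝ᵥ Q *ᵥ x))))
      ∂(Measure.pi fun _ : ι => gaussianReal 0 1) ∂(Measure.pi fun _ : ι => gaussianReal 0 v) =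
      ENNReal.ofReal ((2 : ℝ) ^ (P.trace / 2) * (1 + v / 4 : ℝ) ^ (-(Q.trace / 2))) := by
  obtain ⟨U, p, q, hU, hPU, hQU, hpq⟩ := exists_simultaneous_diagonalization hP hPP hQ hQQ hPQ
  have htr : ∀ A : Matrix ι ι ℝ, A.trace = (Uᵀ * A * U).trace := fun A => by
    rw [trace_mul_comm, ← Matrix.mul_assoc, hU, Matrix.one_mul]
  have hbil : ∀ (A : Matrix ι ι ℝ) (a b : ι → ℝ),
      (U *ᵥ a) ⬝ᵥ A *ᵥ (U *ᵥ b) = a ⬝ᵥ (Uᵀ * A * U) *ᵥ b := fun A a b => by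
    rw [← mulVec_mulVec, ← mulVec_mulVec, dotProduct_mulVec a, vecMul_transpose]
  have hm : Measurable fun x : ι → ℝ => U *ᵥ x := by
    unfold mulVec dotProduct; fun_prop
  have hf : Measurable fun z : (ι → ℝ) × (ι → ℝ) => ENNReal.ofReal (Real.exp (1 / 4 *
      (z.2 ⬝ᵥ P *ᵥ z.2 - z.1 ⬝ᵥ Q *ᵥ z.1 - 2 * (z.1 ⬝ᵥ Q *ᵥ z.2)))) := by
    unfold mulVec dotProduct; fun_prop
  have hf' := fun w : ι → ℝ => hf.comp (measurable_prodMk_left (x := w))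
  dsimp only [Function.comp_def] at hf'
  rw [← map_mulVec_pi_gaussianReal v hU, lintegral_map hf.lintegral_prod_right' hm]
  conv_lhs =>
    enter [2, w]
    rw [← map_mulVec_pi_gaussianReal 1 hU, lintegral_map (hf' _) hm]
  have key : ∀ w x : ι → ℝ, ENNReal.ofReal (Real.exp (1 / 4 * ((U *ᵥ x) ⬝ᵥ P *ᵥ (U *ᵥ x) -
      (U *ᵥ w) ⬝ᵥ Q *ᵥ (U *ᵥ w) - 2 * ((U *ᵥ w) ⬝ᵥ Q *ᵥ (U *ᵥ x))))) =
      ∏ i, ENNReal.ofReal (Real.exp (1 / 4 * (p i * x i ^ 2 - q i * w i ^ 2 -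
        2 * (q i * w i * x i)))) := by
    intro w x
    rw [← ENNReal.ofReal_prod_of_nonneg (fun i _ => (Real.exp_pos _).le), ← Real.exp_sum]
    congr 2
    rw [hbil, hbil, hbil, hPU, hQU]
    simp only [dotProduct, mulVec_diagonal]
    rw [Finset.mul_sum, ← Finset.sum_sub_distrib, ← Finset.sum_sub_distrib, Finset.mul_sum]
    exact Finset.sum_congr rfl fun i _ => by ring
  simp_rw [key]
  conv_lhs =>
    enter [2, w]
    rw [lintegral_pi_prod (fun _ => gaussianReal 0 1)
      (fun i t => ENNReal.ofReal (Real.exp (1 / 4 * (p i * t ^ 2 - q i * w i ^ 2 -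
        2 * (q i * w i * t))))) (fun i => by fun_prop)]
  rw [lintegral_pi_prod (fun _ => gaussianReal 0 v)
    (fun i s => ∫⁻ t, ENNReal.ofReal (Real.exp (1 / 4 * (p i * t ^ 2 - q i * s ^ 2 -
        2 * (q i * s * t)))) ∂gaussianReal 0 1)
    (fun i => Measurable.lintegral_prod_right' (f := fun z : ℝ × ℝ => ENNReal.ofReal
      (Real.exp (1 / 4 * (p i * z.2 ^ 2 - q i * z.1 ^ 2 - 2 * (q i * z.1 * z.2)))))
      (by fun_prop))]
  have hv : (0 : ℝ) < 1 + v / 4 := by positivity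
  rw [Finset.prod_congr rfl fun i _ => lintegral_exp_quadratic_real v (hpq i).1 (hpq i).2.1
    (hpq i).2.2, ← ENNReal.ofReal_prod_of_nonneg (fun i _ => by positivity),
    Finset.prod_mul_distrib, ← Real.rpow_sum_of_pos (by norm_num), ← Real.rpow_sum_of_pos hv,
    htr P, htr Q, hPU, hQU, trace_diagonal, trace_diagonal, Finset.sum_neg_distrib,
    ← Finset.sum_div, ← Finset.sum_div]

theorem map_restrict_dotProduct_pi_gaussianReal {p : ℕ} (S : Finset (Fin p)) {β : Fin p → ℝ}
    (hβ : ∀ j ∈ S, β j = 0) :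
    (Measure.pi fun _ : Fin p => gaussianReal 0 1).map
        (fun x => ((fun j => x j : {j // j ∈ S} → ℝ), x ⬝ᵥ β)) =
      (Measure.pi fun _ : {j // j ∈ S} => gaussianReal 0 1).prod
        (gaussianReal 0 (∑ j, β j ^ 2).toNNReal) := by
  have hsum : ∀ f : Fin p → ℝ, (∀ j ∈ S, f j = 0) → ∑ j, f j = ∑ j : {j // j ∉ S}, f j := by
    intro f hf
    rw [← Fintype.sum_subtype_add_sum_subtype (fun j => j ∈ S) f,
      Finset.sum_eq_zero fun j _ => hf j.1 j.2, zero_add]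
  have hm : Measurable fun y : {j // j ∉ S} → ℝ => y ⬝ᵥ fun j => β j := by
    unfold dotProduct; fun_prop
  have e := measurePreserving_piEquivPiSubtypeProd (fun _ : Fin p => gaussianReal 0 1)
    (fun j => j ∈ S)
  have hfun : (fun x : Fin p → ℝ => ((fun j => x j : {j // j ∈ S} → ℝ), x ⬝ᵥ β)) =
      Prod.map id (fun y : {j // j ∉ S} → ℝ => y ⬝ᵥ fun j => β j) ∘
        MeasurableEquiv.piEquivPiSubtypeProd (fun _ : Fin p => ℝ) (fun j => j ∈ S) := by
    funext x
    refine Prod.ext rfl ?_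
    exact hsum (fun j => x j * β j) fun j hj => by simp [hβ j hj]
  rw [hfun, ← Measure.map_map (measurable_id.prodMap hm) e.measurable, e.map_eq,
    ← Measure.map_prod_map _ _ measurable_id hm, Measure.map_id, map_dotProduct_pi_gaussianReal,
    hsum (fun j => β j ^ 2) fun j hj => by simp [hβ j hj]]
  congr!

theorem map_restrict_mulVec_pi_gaussianReal {n p : ℕ} (S : Finset (Fin p)) {β : Fin p → ℝ}
    (hβ : ∀ j ∈ S, β j = 0) :
    (Measure.pi fun _ : Fin n => Measure.pi fun _ : Fin p => gaussianReal 0 1).map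
        (fun X => ((fun i j => X i j : Fin n → {j // j ∈ S} → ℝ), Matrix.of X *ᵥ β)) =
      (Measure.pi fun _ : Fin n => Measure.pi fun _ : {j // j ∈ S} => gaussianReal 0 1).prod
        (Measure.pi fun _ : Fin n => gaussianReal 0 (∑ j, β j ^ 2).toNNReal) := by
  have hm : Measurable fun x : Fin p → ℝ => ((fun j => x j : {j // j ∈ S} → ℝ), x ⬝ᵥ β) := by
    unfold dotProduct; fun_prop
  have e := measurePreserving_arrowProdEquivProdArrow ({j // j ∈ S} → ℝ) ℝ (Fin n)
    (fun _ => Measure.pi fun _ : {j // j ∈ S} => gaussianReal 0 1)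
    (fun _ => gaussianReal 0 (∑ j, β j ^ 2).toNNReal)
  rw [← e.map_eq, ← map_restrict_dotProduct_pi_gaussianReal S hβ]
  have := Measure.isProbabilityMeasure_map (μ := Measure.pi fun _ : Fin p => gaussianReal 0 1)
    hm.aemeasurable
  rw [← Measure.pi_map_pi (fun _ => hm.aemeasurable), Measure.map_map e.measurable (by fun_prop)]
  rfl

/-- The orthogonal projection onto the column space of a matrix with independent columns. -/
def columnProj {n : ℕ} {ι : Type*} [Fintype ι] [DecidableEq ι] (M : Matrix (Fin n) ι ℝ) :
    Matrix (Fin n) (Fin n) ℝ :=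
  M * (Mᵀ * M)⁻¹ * Mᵀ

section columnProj

variable {n : ℕ} {ι κ : Type*} [Fintype ι] [DecidableEq ι] [Fintype κ] [DecidableEq κ]

theorem measurable_columnProj_apply (i j : Fin n) :
    Measurable fun B : Fin n → ι → ℝ => columnProj (Matrix.of B) i j := by
  have hG : Continuous fun B : Fin n → ι → ℝ => (Matrix.of B)ᵀ * Matrix.of B :=
    (Continuous.matrix_transpose continuous_id).matrix_mul continuous_id
  have hdet := hG.matrix_det.measurable
  have hadj := fun a b => ((hG.matrix_adjugate).matrix_elem a b).measurable
  simp only [columnProj, mul_apply, inv_def, Ring.inverse_eq_inv', Matrix.smul_apply, smul_eq_mul,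
    transpose_apply, of_apply] at hdet hadj ⊢
  refine Finset.measurable_sum _ fun a _ => .mul (Finset.measurable_sum _ fun b _ => ?_) ?_
  · exact .mul (by fun_prop) (.mul hdet.inv (hadj b a))
  · fun_prop

theorem Measurable.columnProj_mulVec {α : Type*} [MeasurableSpace α] {B : α → Fin n → ι → ℝ}
    {u : α → Fin n → ℝ} (hB : Measurable B) (hu : Measurable u) :
    Measurable fun a => columnProj (Matrix.of (B a)) *ᵥ u a := by
  refine measurable_pi_lambda _ fun i => ?_
  simp only [mulVec, dotProduct]
  exact Finset.measurable_fun_sum _ fun j _ =>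
    ((measurable_columnProj_apply i j).comp hB).mul (measurable_pi_iff.mp hu j)

theorem det_transpose_mul_self_ne_zero_iff {M : Matrix (Fin n) ι ℝ} :
    (Mᵀ * M).det ≠ 0 ↔ LinearIndependent ℝ M.col := by
  rw [← mulVec_injective_iff]
  constructor
  · intro h x y hxy
    have hinj := mulVec_injective_iff_isUnit.mpr ((isUnit_iff_isUnit_det _).mpr h.isUnit)
    refine hinj ?_
    simp only [← mulVec_mulVec, hxy]
  · intro h hdet
    obtain ⟨x, hx, hMx⟩ := exists_mulVec_eq_zero_iff.mpr hdet
    have := (conjTranspose_mul_self_mulVec_eq_zero M x).mp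
      (by rwa [conjTranspose_eq_transpose_of_trivial])
    exact hx (h (by rw [this, mulVec_zero]))

theorem columnProj_transpose (M : Matrix (Fin n) ι ℝ) : (columnProj M)ᵀ = columnProj M := by
  simp [columnProj, transpose_mul, transpose_nonsing_inv, Matrix.mul_assoc]

theorem columnProj_mul_self {M : Matrix (Fin n) ι ℝ} (hM : (Mᵀ * M).det ≠ 0) :
    columnProj M * M = M := by
  rw [columnProj, Matrix.mul_assoc, Matrix.mul_assoc, nonsing_inv_mul _ hM.isUnit, Matrix.mul_one]

theorem columnProj_mul_columnProj_submatrix {M : Matrix (Fin n) ι ℝ} (hM : (Mᵀ * M).det ≠ 0)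
    (f : κ → ι) :
    columnProj M * columnProj (M.submatrix id f) = columnProj (M.submatrix id f) := by
  have h : columnProj M * M.submatrix id f = M.submatrix id f := by
    funext i j
    exact congrFun (congrFun (columnProj_mul_self hM) i) (f j)
  conv_lhs => rw [columnProj.eq_1 (M.submatrix id f), ← Matrix.mul_assoc, ← Matrix.mul_assoc, h]
  rfl

theorem columnProj_submatrix_mul_columnProj {M : Matrix (Fin n) ι ℝ} (hM : (Mᵀ * M).det ≠ 0)
    (f : κ → ι) :
    columnProj (M.submatrix id f) * columnProj M = columnProj (M.submatrix id f) := by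
  have := congrArg transpose (columnProj_mul_columnProj_submatrix hM f)
  rwa [transpose_mul, columnProj_transpose, columnProj_transpose] at this

theorem columnProj_mul_columnProj {M : Matrix (Fin n) ι ℝ} (hM : (Mᵀ * M).det ≠ 0) :
    columnProj M * columnProj M = columnProj M :=
  columnProj_mul_columnProj_submatrix hM id

theorem trace_columnProj {M : Matrix (Fin n) ι ℝ} (hM : (Mᵀ * M).det ≠ 0) :
    (columnProj M).trace = Fintype.card ι := by
  rw [columnProj, trace_mul_comm, ← Matrix.mul_assoc, mul_nonsing_inv _ hM.isUnit, trace_one]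

theorem columnProj_ne_one (M : Matrix (Fin n) ι ℝ) (h : Fintype.card ι < n) :
    columnProj M ≠ 1 := by
  intro h1
  have h2 : (columnProj M).rank ≤ Fintype.card ι := by
    rw [columnProj, Matrix.mul_assoc]
    exact (rank_mul_le_left _ _).trans (rank_le_card_width _)
  rw [h1, rank_one, Fintype.card_fin] at h2
  omega

theorem det_transpose_mul_self_submatrix_ne_zero {M : Matrix (Fin n) ι ℝ}
    (hM : (Mᵀ * M).det ≠ 0) {f : κ → ι} (hf : Function.Injective f) :
    ((M.submatrix id f)ᵀ * M.submatrix id f).det ≠ 0 :=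
  det_transpose_mul_self_ne_zero_iff.mpr ((det_transpose_mul_self_ne_zero_iff.mp hM).comp f hf)

theorem measure_fixedPoints_eq_zero {A : Matrix (Fin n) (Fin n) ℝ} (hA : A ≠ 1) :
    (Measure.pi fun _ : Fin n => gaussianReal 0 1) {c | A *ᵥ c = c} = 0 := by
  obtain ⟨i, hi⟩ : ∃ i, (A - 1) i ≠ 0 := by
    by_contra! h
    exact hA (sub_eq_zero.mp (funext h))
  have hm : Measurable fun x : Fin n → ℝ => x ⬝ᵥ (A - 1) i := by
    unfold dotProduct; fun_prop
  have hpos : 0 < ∑ j, (A - 1) i j ^ 2 := by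
    obtain ⟨j, hj⟩ := Function.ne_iff.mp hi
    exact Finset.sum_pos' (fun _ _ => sq_nonneg _)
      ⟨j, Finset.mem_univ j, by have : (A - 1) i j ≠ 0 := hj; positivity⟩
  have := nullSingletonClass_gaussianReal (μ := 0) (Real.toNNReal_pos.mpr hpos).ne'
  refine measure_mono_null (t := (fun x => x ⬝ᵥ (A - 1) i) ⁻¹' {0}) ?_ ?_
  · intro c hc
    have : ((A - 1) *ᵥ c) i = 0 := by
      rw [sub_mulVec, one_mulVec, show A *ᵥ c = c from hc, sub_self]; rfl
    rwa [mulVec, dotProduct_comm] at this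
  · rw [← Measure.map_apply hm (measurableSet_singleton 0), map_dotProduct_pi_gaussianReal]
    exact measure_singleton 0

end columnProj

theorem ae_linearIndepOn_columns {n p : ℕ} (S : Finset (Fin p)) (hS : S.card ≤ n) :
    ∀ᵐ X ∂(Measure.pi fun _ : Fin n => Measure.pi fun _ : Fin p => gaussianReal 0 1),
      LinearIndepOn ℝ (fun j i => X i j) (S : Set (Fin p)) := by
  induction S using Finset.induction_on with
  | empty => simp
  | insert a S ha ih =>
    rw [Finset.card_insert_of_notMem ha] at hS
    have hβ : ∀ j ∈ S, (Pi.single a 1 : Fin p → ℝ) j = 0 := fun j hj =>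
      Pi.single_eq_of_ne (by rintro rfl; exact ha hj) 1
    have hv : (∑ j, (Pi.single a 1 : Fin p → ℝ) j ^ 2).toNNReal = 1 := by
      simp [Pi.single_apply]
    have hmap := map_restrict_mulVec_pi_gaussianReal (n := n) S hβ
    rw [hv] at hmap
    have hmeas : MeasurableSet {z : (Fin n → {j // j ∈ S} → ℝ) × (Fin n → ℝ) |
        columnProj (Matrix.of z.1) *ᵥ z.2 = z.2} :=
      measurableSet_eq_fun (measurable_fst.columnProj_mulVec measurable_snd) measurable_snd
    have hnull : ((Measure.pi fun _ : Fin n => Measure.pi fun _ : {j // j ∈ S} =>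
        gaussianReal 0 1).prod (Measure.pi fun _ : Fin n => gaussianReal 0 1))
        {z | columnProj (Matrix.of z.1) *ᵥ z.2 = z.2} = 0 := by
      rw [Measure.measure_prod_null hmeas]
      refine .of_forall fun B => measure_fixedPoints_eq_zero (columnProj_ne_one _ ?_)
      rw [Fintype.card_coe]; omega
    rw [← hmap] at hnull
    have hm : Measurable fun X : Fin n → Fin p → ℝ =>
        ((fun i j => X i j : Fin n → {j // j ∈ S} → ℝ),
          Matrix.of X *ᵥ (Pi.single a 1 : Fin p → ℝ)) := by
      unfold mulVec dotProduct; simp only [of_apply]; fun_prop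
    rw [Measure.map_apply hm hmeas] at hnull
    filter_upwards [ih (by omega), measure_eq_zero_iff_ae_notMem.mp hnull] with X hX hXa
    rw [Finset.coe_insert]
    refine hX.insert fun hmem => hXa ?_
    have hM := det_transpose_mul_self_ne_zero_iff.mpr
      (show LinearIndependent ℝ (colSub (Matrix.of X) S).col from hX)
    obtain ⟨x, hx⟩ : ∃ x, colSub (Matrix.of X) S *ᵥ x = fun i => X i a := by
      have : (fun i => X i a) ∈ LinearMap.range (colSub (Matrix.of X) S).mulVecLin := by
        rw [range_mulVecLin]
        rwa [Set.image_eq_range] at hmem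
      exact this
    have hcol : Matrix.of X *ᵥ (Pi.single a 1 : Fin p → ℝ) = fun i => X i a := by
      funext i; simp
    change columnProj (colSub (Matrix.of X) S) *ᵥ (Matrix.of X *ᵥ (Pi.single a 1 : Fin p → ℝ)) =
      Matrix.of X *ᵥ (Pi.single a 1 : Fin p → ℝ)
    rw [hcol, ← hx, mulVec_mulVec, columnProj_mul_self hM]

theorem measurable_sqnorm {n : ℕ} : Measurable (sqnorm : (Fin n → ℝ) → ℝ) := by
  unfold sqnorm; fun_prop

theorem sqnorm_sub_mulVec {n : ℕ} {A : Matrix (Fin n) (Fin n) ℝ} (hA : Aᵀ = A) (hAA : A * A = A)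
    (v : Fin n → ℝ) : sqnorm (v - A *ᵥ v) = v ⬝ᵥ (1 - A) *ᵥ v := by
  have h : v - A *ᵥ v = (1 - A) *ᵥ v := by rw [sub_mulVec, one_mulVec]
  have h1 : (1 - A)ᵀ * (1 - A) = 1 - A := by
    rw [transpose_sub, transpose_one, hA, mul_sub, sub_mul, sub_mul, hAA]; simp
  have h2 : sqnorm (v - A *ᵥ v) = (v - A *ᵥ v) ⬝ᵥ (v - A *ᵥ v) := by
    simp [sqnorm, dotProduct, pow_two]
  rw [h2, h, dotProduct_mulVec, ← mulVec_transpose, mulVec_mulVec, h1, dotProduct_comm]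

theorem sqnorm_sub_mulVec_le {n : ℕ} {A : Matrix (Fin n) (Fin n) ℝ} (hA : Aᵀ = A)
    (hAA : A * A = A) (v : Fin n → ℝ) : sqnorm (v - A *ᵥ v) ≤ sqnorm v := by
  have h : v ⬝ᵥ A *ᵥ v = (A *ᵥ v) ⬝ᵥ (A *ᵥ v) := by
    rw [dotProduct_mulVec (A *ᵥ v), ← mulVec_transpose, hA, mulVec_mulVec, hAA, dotProduct_comm]
  rw [sqnorm_sub_mulVec hA hAA, sub_mulVec, one_mulVec, dotProduct_sub, h]
  have h2 : sqnorm v = v ⬝ᵥ v := by simp [sqnorm, dotProduct, pow_two]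
  have h3 : 0 ≤ (A *ᵥ v) ⬝ᵥ (A *ᵥ v) := Finset.sum_nonneg fun i _ => mul_self_nonneg _
  linarith

theorem lintegral_measure_residual_lt_le {n : ℕ} {ι κ : Type*} [Fintype ι] [DecidableEq ι]
    [Fintype κ] [DecidableEq κ] (v : NNReal) {M : Matrix (Fin n) ι ℝ} (hM : (Mᵀ * M).det ≠ 0)
    {f : κ → ι} (hf : Function.Injective f) :
    ∫⁻ w, (Measure.pi fun _ : Fin n => gaussianReal 0 1)
        {e | sqnorm ((w + e) - columnProj M *ᵥ (w + e)) <
          sqnorm (e - columnProj (M.submatrix id f) *ᵥ e)}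
      ∂(Measure.pi fun _ : Fin n => gaussianReal 0 v) ≤
      ENNReal.ofReal ((2 : ℝ) ^ (((Fintype.card ι : ℝ) - Fintype.card κ) / 2) *
        (1 + v / 4 : ℝ) ^ (-(((n : ℝ) - Fintype.card ι) / 2))) := by
  have hN := det_transpose_mul_self_submatrix_ne_zero hM hf
  set A := columnProj M
  set B := columnProj (M.submatrix id f)
  have hA : Aᵀ = A := columnProj_transpose M
  have hB : Bᵀ = B := columnProj_transpose _
  have hAA : A * A = A := columnProj_mul_columnProj hM
  have hBB : B * B = B := columnProj_mul_columnProj hN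
  have hAB : A * B = B := columnProj_mul_columnProj_submatrix hM f
  have hBA : B * A = B := columnProj_submatrix_mul_columnProj hM f
  have hquad := lintegral_exp_quadratic v (P := A - B) (Q := 1 - A)
    (by rw [transpose_sub, hA, hB])
    (by rw [mul_sub, sub_mul, sub_mul, hAA, hBA, hAB, hBB]; simp)
    (by rw [transpose_sub, transpose_one, hA])
    (by rw [mul_sub, sub_mul, sub_mul, hAA]; simp)
    (by rw [mul_sub, sub_mul, sub_mul, hAA, hBA]; simp)
  rw [trace_sub, trace_sub, trace_one, trace_columnProj hM, trace_columnProj hN,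
    Fintype.card_fin] at hquad
  rw [← hquad]
  refine lintegral_mono fun w => ?_
  have hmeas : Measurable fun x : Fin n → ℝ => ENNReal.ofReal (Real.exp (1 / 4 *
      (x ⬝ᵥ (A - B) *ᵥ x - w ⬝ᵥ (1 - A) *ᵥ w - 2 * (w ⬝ᵥ (1 - A) *ᵥ x)))) := by
    unfold mulVec dotProduct; fun_prop
  refine le_trans (measure_mono fun e he => ?_)
    ((one_mul _).symm.le.trans (mul_meas_ge_le_lintegral hmeas 1))
  rw [Set.mem_ofPred_eq, sqnorm_sub_mulVec hA hAA, sqnorm_sub_mulVec hB hBB] at he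
  rw [Set.mem_ofPred_eq, ENNReal.one_le_ofReal, Real.one_le_exp_iff]
  have h1 : e ⬝ᵥ (1 - A) *ᵥ w = w ⬝ᵥ (1 - A) *ᵥ e := by
    rw [dotProduct_mulVec, ← mulVec_transpose, transpose_sub, transpose_one, hA, dotProduct_comm]
  have h2 : e ⬝ᵥ (1 - B) *ᵥ e = e ⬝ᵥ (A - B) *ᵥ e + e ⬝ᵥ (1 - A) *ᵥ e := by
    rw [← dotProduct_add, ← add_mulVec]
    congr 2; abel
  rw [mulVec_add, dotProduct_add, add_dotProduct, add_dotProduct, h1, h2] at he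
  linarith

theorem chernoff_constant_le {b r d : ℝ} (hb : 0 ≤ b) (hr : 0 ≤ r) (hd : 0 ≤ d) :
    (2 : ℝ) ^ (d / 2) * (1 + b / 4) ^ (-(r / 2)) ≤
      Real.exp (-(r / 2) * Real.log (1 + 2 * ((3 - 2 * √2) / 2) * b) + d / 2) := by
  have hs : (11 / 8 : ℝ) ≤ √2 := Real.le_sqrt_of_sq_le (by norm_num)
  have hs' : √2 ≤ 3 / 2 := Real.sqrt_le_iff.mpr (by norm_num)
  have h0 : 0 ≤ (3 - 2 * √2) * b := mul_nonneg (by linarith) hb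
  have hlog : Real.log (1 + 2 * ((3 - 2 * √2) / 2) * b) ≤ Real.log (1 + b / 4) :=
    Real.log_le_log (by linarith) (by nlinarith)
  rw [Real.rpow_def_of_pos (by norm_num), Real.rpow_def_of_pos (by linarith), ← Real.exp_add,
    Real.exp_le_exp]
  have hlog2 : Real.log 2 ≤ 1 := by linarith [Real.log_two_lt_d9]
  nlinarith [mul_le_mul_of_nonneg_left hlog hr, mul_le_mul_of_nonneg_left hlog2 hd]

theorem proj_mulVec_mulVec {n p : ℕ} {X : Matrix (Fin n) (Fin p) ℝ} {S : Finset (Fin p)}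
    (hX : ((colSub X S)ᵀ * colSub X S).det ≠ 0) {β : Fin p → ℝ} (hβ : ∀ j ∉ S, β j = 0) :
    proj X S *ᵥ (X *ᵥ β) = X *ᵥ β := by
  have h : X *ᵥ β = colSub X S *ᵥ fun j => β j := by
    funext i
    change ∑ j, X i j * β j = ∑ j : {j // j ∈ S}, X i j * β j
    rw [Finset.sum_coe_sort S fun j => X i j * β j]
    exact (Finset.sum_subset S.subset_univ fun j _ hj => by rw [hβ j hj, mul_zero]).symm
  rw [h, mulVec_mulVec, show proj X S = columnProj (colSub X S) from rfl, columnProj_mul_self hX]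

theorem residual_lt_of_decoder_prefers {n p : ℕ} {X : Matrix (Fin n) (Fin p) ℝ}
    {T F : Finset (Fin p)} (hT : ((colSub X T)ᵀ * colSub X T).det ≠ 0)
    (hF : ((colSub X F)ᵀ * colSub X F).det ≠ 0) {β : Fin p → ℝ} (hβ : ∀ j ∉ T, β j = 0)
    {e : Fin n → ℝ}
    (h : sqnorm (X *ᵥ β + e - proj X F *ᵥ (X *ᵥ β + e)) <
      sqnorm (X *ᵥ β + e - proj X T *ᵥ (X *ᵥ β + e))) :
    sqnorm (X *ᵥ restr β (T \ F) + e - proj X F *ᵥ (X *ᵥ restr β (T \ F) + e)) <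
      sqnorm (e - proj X (F ∩ T) *ᵥ e) := by
  have hsplit : X *ᵥ β = X *ᵥ restr β F + X *ᵥ restr β (T \ F) := by
    rw [← mulVec_add]
    congr 1
    funext j
    by_cases hjF : j ∈ F <;> by_cases hjT : j ∈ T <;> simp [restr, hjF, hjT, hβ]
  have hfix : proj X F *ᵥ (X *ᵥ restr β F) = X *ᵥ restr β F :=
    proj_mulVec_mulVec hF fun j hj => by simp [restr, hj]
  have hl : X *ᵥ β + e - proj X F *ᵥ (X *ᵥ β + e) =
      X *ᵥ restr β (T \ F) + e - proj X F *ᵥ (X *ᵥ restr β (T \ F) + e) := by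
    rw [hsplit]
    simp only [mulVec_add, hfix]
    abel
  have hmul : proj X T * proj X (F ∩ T) = proj X (F ∩ T) :=
    columnProj_mul_columnProj_submatrix hT
      fun j : {j // j ∈ F ∩ T} => ⟨j, (Finset.mem_inter.mp j.2).2⟩
  have hr : X *ᵥ β + e - proj X T *ᵥ (X *ᵥ β + e) =
      (e - proj X (F ∩ T) *ᵥ e) - proj X T *ᵥ (e - proj X (F ∩ T) *ᵥ e) := by
    rw [mulVec_add, proj_mulVec_mulVec hT hβ, mulVec_sub, mulVec_mulVec, hmul]
    abel
  rw [hl, hr] at h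
  exact h.trans_le (sqnorm_sub_mulVec_le (columnProj_transpose _) (columnProj_mul_columnProj hT) _)

theorem measurableSet_det_ne_zero_and_residual_lt {n : ℕ} {ι κ : Type*} [Fintype ι]
    [DecidableEq ι] [Fintype κ] [DecidableEq κ] (f : κ → ι) :
    MeasurableSet {z : ((Fin n → ι → ℝ) × (Fin n → ℝ)) × (Fin n → ℝ) |
      ((Matrix.of z.1.1)ᵀ * Matrix.of z.1.1).det ≠ 0 ∧
        sqnorm ((z.1.2 + z.2) - columnProj (Matrix.of z.1.1) *ᵥ (z.1.2 + z.2)) <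
          sqnorm (z.2 - columnProj ((Matrix.of z.1.1).submatrix id f) *ᵥ z.2)} := by
  have hdet : Continuous fun z : ((Fin n → ι → ℝ) × (Fin n → ℝ)) × (Fin n → ℝ) =>
      ((Matrix.of z.1.1)ᵀ * Matrix.of z.1.1).det :=
    have hof : Continuous fun z : ((Fin n → ι → ℝ) × (Fin n → ℝ)) × (Fin n → ℝ) =>
      Matrix.of z.1.1 := continuous_fst.fst
    (hof.matrix_transpose.matrix_mul hof).matrix_det
  have hadd : Measurable fun z : ((Fin n → ι → ℝ) × (Fin n → ℝ)) × (Fin n → ℝ) =>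
      z.1.2 + z.2 := by fun_prop
  have hsub : Measurable fun z : ((Fin n → ι → ℝ) × (Fin n → ℝ)) × (Fin n → ℝ) =>
      (fun i j => z.1.1 i (f j) : Fin n → κ → ℝ) := by fun_prop
  have hl := measurable_sqnorm.comp (hadd.sub (measurable_fst.fst.columnProj_mulVec hadd))
  have hr := measurable_sqnorm.comp
    (measurable_snd.sub (hsub.columnProj_mulVec measurable_snd))
  exact (hdet.measurable (measurableSet_singleton 0).compl).inter (measurableSet_lt hl hr)

theorem prod_measure_residual_lt_le {n : ℕ} {ι κ : Type*} [Fintype ι] [DecidableEq ι]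
    [Fintype κ] [DecidableEq κ] (v : NNReal) {f : κ → ι} (hf : Function.Injective f) :
    (((Measure.pi fun _ : Fin n => Measure.pi fun _ : ι => gaussianReal 0 1).prod
      (Measure.pi fun _ : Fin n => gaussianReal 0 v)).prod
      (Measure.pi fun _ : Fin n => gaussianReal 0 1))
      {z | ((Matrix.of z.1.1)ᵀ * Matrix.of z.1.1).det ≠ 0 ∧
        sqnorm ((z.1.2 + z.2) - columnProj (Matrix.of z.1.1) *ᵥ (z.1.2 + z.2)) <
          sqnorm (z.2 - columnProj ((Matrix.of z.1.1).submatrix id f) *ᵥ z.2)} ≤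
      ENNReal.ofReal ((2 : ℝ) ^ (((Fintype.card ι : ℝ) - Fintype.card κ) / 2) *
        (1 + v / 4 : ℝ) ^ (-(((n : ℝ) - Fintype.card ι) / 2))) := by
  have hmeas := measurableSet_det_ne_zero_and_residual_lt (n := n) f
  rw [Measure.prod_apply hmeas,
    lintegral_prod _ (measurable_measure_prodMk_left hmeas).aemeasurable]
  refine (lintegral_mono (g := fun _ => ENNReal.ofReal
    ((2 : ℝ) ^ (((Fintype.card ι : ℝ) - Fintype.card κ) / 2) *
      (1 + v / 4 : ℝ) ^ (-(((n : ℝ) - Fintype.card ι) / 2)))) fun B => ?_).trans (by simp)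
  by_cases hB : ((Matrix.of B)ᵀ * Matrix.of B).det = 0
  · simp [hB]
  · simpa [hB] using lintegral_measure_residual_lt_le v hB hf

/-- **Lemma 2.** For i.i.d. `N(0,1)` perturbation matrices,
the probability (over `X` and `ε`) that the optimal decoder prefers a size-`k`
pattern `F ≠ T` to the true pattern `T` is at most
`exp(-((n-k)/2) log(1 + 2c ‖β_{T∖F}‖²) + d/2)` with `d = |T ∖ F|` and
`c = (3 - 2√2)/2`. -/
theorem gaussian_pairwise_error_bound {n p k : ℕ} (hkn : k ≤ n)
    (T F : Finset (Fin p)) (hT : T.card = k) (hF : F.card = k) (hFT : F ≠ T)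
    (β : Fin p → ℝ) (hβ : ∀ i ∉ T, β i = 0) :
    jointGaussian n p
      {ω | sqnorm ((Matrix.of ω.1).mulVec β + ω.2 -
              (proj (Matrix.of ω.1) F).mulVec ((Matrix.of ω.1).mulVec β + ω.2)) <
            sqnorm ((Matrix.of ω.1).mulVec β + ω.2 -
              (proj (Matrix.of ω.1) T).mulVec ((Matrix.of ω.1).mulVec β + ω.2))} ≤
      ENNReal.ofReal (Real.exp
        (-(((n : ℝ) - k) / 2) *
            Real.log (1 + 2 * ((3 - 2 * Real.sqrt 2) / 2) *
              ∑ i ∈ T \ F, (β i) ^ 2) +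
          ((T \ F).card : ℝ) / 2)) := by
  set β' := restr β (T \ F) with hβ'
  have hβ'F : ∀ j ∈ F, β' j = 0 := fun j hj => by simp [hβ', restr, hj]
  have hsum : ∑ j, β' j ^ 2 = ∑ i ∈ T \ F, β i ^ 2 := by
    simp [hβ', restr, ite_pow, -Finset.mem_sdiff]
  have hb : 0 ≤ ∑ i ∈ T \ F, β i ^ 2 := Finset.sum_nonneg fun i _ => sq_nonneg _
  have hcard : (F ∩ T).card + (T \ F).card = k := by
    rw [Finset.inter_comm, add_comm, Finset.card_sdiff_add_card_inter, hT]
  let f : {j // j ∈ F ∩ T} → {j // j ∈ F} := fun j => ⟨j, (Finset.mem_inter.mp j.2).1⟩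
  have hf : Function.Injective f := fun i j hij => Subtype.ext (Subtype.mk.inj hij)
  have hbound := prod_measure_residual_lt_le (n := n) (∑ j, β' j ^ 2).toNNReal hf
  have hΦ : Measurable fun X : Fin n → Fin p → ℝ =>
      ((fun i j => X i j : Fin n → {j // j ∈ F} → ℝ), Matrix.of X *ᵥ β') := by
    unfold mulVec dotProduct; simp only [of_apply]; fun_prop
  rw [← map_restrict_mulVec_pi_gaussianReal F hβ'F,
    ← Measure.map_id (μ := Measure.pi fun _ : Fin n => gaussianReal 0 1),
    Measure.map_prod_map _ _ hΦ measurable_id,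
    Measure.map_apply (hΦ.prodMap measurable_id) (measurableSet_det_ne_zero_and_residual_lt f),
    hsum, Real.coe_toNNReal _ hb, Fintype.card_coe, Fintype.card_coe, hF] at hbound
  have hdet (S : Finset (Fin p)) (hS : S.card ≤ n) : ∀ᵐ ω ∂jointGaussian n p,
      ((colSub (Matrix.of ω.1) S)ᵀ * colSub (Matrix.of ω.1) S).det ≠ 0 := by
    filter_upwards [Measure.quasiMeasurePreserving_fst.ae (ae_linearIndepOn_columns S hS)]
      with ω hω
    exact det_transpose_mul_self_ne_zero_iff.mpr hω
  refine ((measure_mono_ae ?_).trans hbound).trans (ENNReal.ofReal_le_ofReal ?_)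
  · filter_upwards [hdet T (hT.trans_le hkn), hdet F (hF.trans_le hkn)] with ω hωT hωF hω
    exact ⟨hωF, residual_lt_of_decoder_prefers hωT hωF hβ hω⟩
  · have hd : (k : ℝ) - (F ∩ T).card = (T \ F).card := by
      rw [← hcard]; push_cast; ring
    rw [hd]
    exact chernoff_constant_le hb (sub_nonneg.mpr (Nat.cast_le.mpr hkn)) (Nat.cast_nonneg _)

end
end

section
/- Consider a sequence of models indexed by p: y⁽ᵖ⁾ = X⁽ᵖ⁾β⁽ᵖ⁾ + ε⁽ᵖ⁾, where X⁽ᵖ⁾ ∈ ℝ^{n(p)×p} has i.i.d. N(0,1) entries, β⁽ᵖ⁾ ∈ ℝ^p is supported on a size-k(p) set T_p with minimum nonzero magnitude β_min(p), and ε⁽ᵖ⁾ ∼ N(0, I_{n(p)}) is independent of X⁽ᵖ⁾. Suppose (n(p) − k(p))·β_min(p)² > 4·(1 + k(p)·β_min(p)²)²/(k(p)·β_min(p)²) for all p. Then there exists a constant C* such that, if n(p) > C* · max{ log(p − k(p)) / log(1 + β_min(p)²), k(p)·log(p/k(p)) / log(1 + k(p)·β_min(p)²), k(p) } for all large p, then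 the error probabilities are summable: Σ_p Pr[ S(β̂⁽ᵖ⁾) ≠ T_p ] < ∞; in particular Pr[ S(β̂⁽ᵖ⁾) ≠ T_p ] → 0 as p → ∞, and (by Borel–Cantelli, for independent copies of the experiments on a common probability space) almost surely S(β̂⁽ᵖ⁾) = T_p for all sufficiently large p. -/
open MeasureTheory ProbabilityTheory Matrix

noncomputable section

/-- The probability (over `X` and `ε`) of the error event of the optimal
decoder: some size-`k` pattern `F ≠ T` fits the data `y = Xβ + ε` at least as
well as the true pattern `T`. -/
def errP (n k : ℕ) {p : ℕ} (β : Fin p → ℝ) (T : Finset (Fin p)) : ENNReal :=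
  jointGaussian n p
    {ω | ∃ F : Finset (Fin p), F.card = k ∧ F ≠ T ∧
      sqnorm ((Matrix.of ω.1).mulVec β + ω.2 -
          (proj (Matrix.of ω.1) F).mulVec ((Matrix.of ω.1).mulVec β + ω.2)) ≤
        sqnorm ((Matrix.of ω.1).mulVec β + ω.2 -
          (proj (Matrix.of ω.1) T).mulVec ((Matrix.of ω.1).mulVec β + ω.2))}

section

open scoped ENNReal NNReal

lemma lintegral_exp_mul_sq_gaussianReal_s14 {v : ℝ≥0} (hv : v ≠ 0) {a : ℝ} (ha : 2 * a * v < 1) :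
    ∫⁻ x, ENNReal.ofReal (Real.exp (a * x ^ 2)) ∂(gaussianReal 0 v) =
      ENNReal.ofReal (√(1 - 2 * a * v))⁻¹ := by
  have hv' : (0 : ℝ) < v := by positivity
  have hc : 0 < 1 - 2 * a * v := by linarith
  set v' : ℝ≥0 := ⟨v / (1 - 2 * a * v), by positivity⟩ with hv'def
  have hw0 : v' ≠ 0 := by
    rw [← NNReal.coe_ne_zero]; change v / (1 - 2 * a * v) ≠ 0; positivity
  have hcoe : (v' : ℝ) = v / (1 - 2 * a * v) := rfl
  rw [gaussianReal_of_var_ne_zero _ hv, lintegral_withDensity_eq_lintegral_mul _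
    (measurable_gaussianPDF _ _) (by fun_prop)]
  have key : ∀ x, (gaussianPDF 0 v * fun x => ENNReal.ofReal (Real.exp (a * x ^ 2))) x =
      ENNReal.ofReal (√(1 - 2 * a * v))⁻¹ * gaussianPDF 0 v' x := by
    intro x
    rw [Pi.mul_apply, gaussianPDF, gaussianPDF, ← ENNReal.ofReal_mul (gaussianPDFReal_nonneg _ _ _),
      ← ENNReal.ofReal_mul (by positivity), gaussianPDFReal, gaussianPDFReal, hcoe]
    congr 1
    rw [mul_assoc, ← Real.exp_add, ← mul_assoc, ← mul_inv, ← Real.sqrt_mul hc.le]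
    have hs : 2 * Real.pi * v = (1 - 2 * a * v) * (2 * Real.pi * (v / (1 - 2 * a * v))) := by
      rw [mul_left_comm, mul_div_cancel₀ _ hc.ne']
    rw [← hs]
    congr 2
    · field_simp; ring
  simp_rw [key]
  rw [lintegral_const_mul _ (measurable_gaussianPDF _ _), lintegral_gaussianPDF_eq_one _ hw0,
    mul_one]

lemma lintegral_exp_mul_gaussianReal (v : ℝ≥0) (t : ℝ) :
    ∫⁻ x, ENNReal.ofReal (Real.exp (t * x)) ∂(gaussianReal 0 v) =
      ENNReal.ofReal (Real.exp (v * t ^ 2 / 2)) := by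
  rw [← ofReal_integral_eq_lintegral_ofReal (integrable_exp_mul_gaussianReal t)
    (ae_of_all _ fun _ => (Real.exp_pos _).le)]
  have := mgf_gaussianReal (p := gaussianReal 0 v) (X := id) (μ := 0) (v := v) (by simp) t
  simp only [mgf, id, zero_mul, zero_add] at this
  rw [this]

/-- The law of a linear functional of a standard Gaussian vector. -/
lemma map_sum_mul_pi_gaussianReal {ι : Type*} [Fintype ι] (c : ι → ℝ) :
    (Measure.pi fun _ : ι => gaussianReal 0 1).map (fun x => ∑ i, x i * c i) =
      gaussianReal 0 (∑ i, (c i ^ 2).toNNReal) := by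
  have hm : Measurable fun x : ι → ℝ => ∑ i, x i * c i := by fun_prop
  have := Measure.isProbabilityMeasure_map (μ := Measure.pi fun _ : ι => gaussianReal 0 1)
    hm.aemeasurable
  apply Measure.ext_of_charFun
  ext t
  rw [charFun_gaussianReal, charFun_apply_real, integral_map hm.aemeasurable (by fun_prop)]
  have : ∀ x : ι → ℝ, Complex.exp (t * ((∑ i, x i * c i : ℝ) : ℂ) * Complex.I) =
      ∏ i, Complex.exp (((t * c i : ℝ) : ℂ) * x i * Complex.I) := by
    intro x
    rw [← Complex.exp_sum]
    congr 1
    push_cast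
    rw [Finset.mul_sum, Finset.sum_mul]
    exact Finset.sum_congr rfl fun i _ => by ring
  simp_rw [this]
  rw [integral_fintype_prod_eq_prod
    (f := fun i (x : ℝ) => Complex.exp (((t * c i : ℝ) : ℂ) * x * Complex.I))]
  simp_rw [← charFun_apply_real, charFun_gaussianReal]
  rw [← Complex.exp_sum]
  congr 1
  push_cast
  simp only [Real.coe_toNNReal _ (sq_nonneg _)]
  push_cast
  rw [Finset.sum_mul, Finset.sum_div, mul_zero, zero_mul, zero_sub, ← Finset.sum_neg_distrib]
  exact Finset.sum_congr rfl fun i _ => by ring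

lemma lintegral_pi_prod_eq_prod {ι α : Type*} [Fintype ι] [MeasurableSpace α]
    (μ : Measure α) [IsProbabilityMeasure μ] (f : ι → α → ℝ≥0∞) (hf : ∀ i, Measurable (f i)) :
    ∫⁻ x, ∏ i, f i (x i) ∂(Measure.pi fun _ : ι => μ) = ∏ i, ∫⁻ a, f i a ∂μ := by
  rw [lintegral_prod_eq_prod_lintegral_of_indepFun Finset.univ (fun i (x : ι → α) => f i (x i))
    (iIndepFun_pi fun i => (hf i).aemeasurable)
    (fun i => (hf i).comp (measurable_pi_apply i))]
  refine Finset.prod_congr rfl fun i _ => ?_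
  rw [← (measurePreserving_eval (fun _ : ι => μ) i).lintegral_comp (hf i)]

lemma map_orthogonal_mulVec_pi_gaussianReal {ι : Type*} [Fintype ι] [DecidableEq ι]
    (U : Matrix ι ι ℝ) (hU : U ∈ Matrix.orthogonalGroup ι ℝ) (v : ℝ≥0) :
    MeasurePreserving (fun x => U.mulVec x) (Measure.pi fun _ : ι => gaussianReal 0 v)
      (Measure.pi fun _ : ι => gaussianReal 0 v) := by
  have hm : Measurable fun x : ι → ℝ => U.mulVec x :=
    (Continuous.matrix_mulVec continuous_const continuous_id).measurable
  refine ⟨hm, ?_⟩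
  have hmass : ∀ x : ι → ℝ, (√(v : ℝ)) • U.mulVec x = U.mulVec ((√(v : ℝ)) • x) := fun x => by
    rw [Matrix.mulVec_smul]
  have h1 : (Measure.pi fun _ : ι => gaussianReal 0 1).map (fun x => U.mulVec x) =
      Measure.pi fun _ : ι => gaussianReal 0 1 := by
    have := Measure.isProbabilityMeasure_map (μ := Measure.pi fun _ : ι => gaussianReal 0 1)
      hm.aemeasurable
    have h2 : ((Measure.pi fun _ : ι => gaussianReal 0 1).map (fun x => U.mulVec x)).map
        (WithLp.toLp 2) = (Measure.pi fun _ : ι => gaussianReal 0 1).map (WithLp.toLp 2) := by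
      apply Measure.ext_of_charFun (E := EuclideanSpace ℝ ι)
      ext t
      rw [map_pi_eq_stdGaussian, charFun_stdGaussian, charFun_apply,
        integral_map (by fun_prop) (by fun_prop), integral_map hm.aemeasurable (by fun_prop)]
      have h3 : ∀ x : ι → ℝ, inner ℝ (WithLp.toLp 2 (U.mulVec x)) t =
          inner ℝ (WithLp.toLp 2 x) (WithLp.toLp 2 (Uᵀ.mulVec t.ofLp)) := by
        intro x
        simp only [EuclideanSpace.inner_eq_star_dotProduct, star_trivial]
        rw [Matrix.dotProduct_mulVec, ← Matrix.mulVec_transpose]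
      simp_rw [h3]
      rw [← integral_map (μ := Measure.pi fun _ : ι => gaussianReal 0 1)
        (φ := (WithLp.toLp 2 : (ι → ℝ) → EuclideanSpace ℝ ι))
        (f := fun x => Complex.exp ((inner ℝ x (WithLp.toLp 2 (Uᵀ.mulVec t.ofLp)) : ℝ) * Complex.I))
        (by fun_prop) (by fun_prop), ← charFun_apply, map_pi_eq_stdGaussian, charFun_stdGaussian]
      have h4 : ‖(WithLp.toLp 2 (Uᵀ.mulVec t.ofLp) : EuclideanSpace ℝ ι)‖ ^ 2 = ‖t‖ ^ 2 := by
        rw [← real_inner_self_eq_norm_sq, ← real_inner_self_eq_norm_sq, ← h3,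
          Matrix.mulVec_mulVec, (Matrix.mem_orthogonalGroup_iff ι ℝ).1 hU, Matrix.one_mulVec]
      rw [(sq_eq_sq₀ (norm_nonneg _) (norm_nonneg _)).1 h4]
    have h5 := congrArg (Measure.map (WithLp.ofLp (p := 2) (V := ι → ℝ))) h2
    rw [Measure.map_map (by fun_prop) (by fun_prop),
      Measure.map_map (by fun_prop) (by fun_prop), Measure.map_map (by fun_prop) (by fun_prop)] at h5
    simpa only [Function.comp_def, Measure.map_id'] using h5
  have hv : (Measure.pi fun _ : ι => gaussianReal 0 v) =
      (Measure.pi fun _ : ι => gaussianReal 0 1).map (fun x => (√(v : ℝ)) • x) := by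
    have h6 : (gaussianReal 0 1).map (fun x => √(v : ℝ) * x) = gaussianReal 0 v := by
      rw [gaussianReal_map_const_mul]
      congr 1
      · simp
      · ext; simp
    have h7 : IsProbabilityMeasure ((gaussianReal 0 1).map (fun x => √(v : ℝ) * x)) := by
      rw [h6]; infer_instance
    have := Measure.pi_map_pi (μ := fun _ : ι => gaussianReal 0 1)
      (f := fun _ x => √(v : ℝ) * x) (fun i => by fun_prop)
    rw [h6] at this
    rw [← this]
    rfl
  rw [hv, Measure.map_map hm (by fun_prop)]
  have : (fun x : ι → ℝ => U.mulVec x) ∘ (fun x => (√(v : ℝ)) • x) =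
      (fun x => (√(v : ℝ)) • x) ∘ (fun x : ι → ℝ => U.mulVec x) := by
    ext x; simp [Matrix.mulVec_smul]
  rw [this, ← Measure.map_map (by fun_prop) hm, h1]

/-- Nested orthogonal projections are simultaneously diagonalizable. -/
lemma exists_orthogonal_diagonalization_of_nested {ι : Type*} [Fintype ι] [DecidableEq ι]
    {P R : Matrix ι ι ℝ} (hPt : Pᵀ = P) (hRt : Rᵀ = R) (hPP : P * P = P) (hRR : R * R = R)
    (hPR : P * R = R) :
    ∃ U ∈ Matrix.orthogonalGroup ι ℝ, ∃ a b : ι → ℝ, P = U * diagonal a * Uᵀ ∧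
      R = U * diagonal b * Uᵀ ∧
      ∀ i, (a i = 1 ∧ b i = 1) ∨ (a i = 1 ∧ b i = 0) ∨ (a i = 0 ∧ b i = 0) := by
  have hRP : R * P = R := by
    have := congrArg Matrix.transpose hPR
    rwa [Matrix.transpose_mul, hPt, hRt] at this
  have hM : (P + R).IsHermitian := by
    rw [Matrix.IsHermitian, Matrix.conjTranspose_eq_transpose_of_trivial, Matrix.transpose_add,
      hPt, hRt]
  set U : Matrix ι ι ℝ := (hM.eigenvectorUnitary : Matrix ι ι ℝ) with hU
  set m := hM.eigenvalues with hm
  have hUm : U ∈ Matrix.orthogonalGroup ι ℝ := hM.eigenvectorUnitary.2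
  have h1 : U * Uᵀ = 1 := (Matrix.mem_orthogonalGroup_iff ι ℝ).1 hUm
  have h2 : Uᵀ * U = 1 := (Matrix.mem_orthogonalGroup_iff' ι ℝ).1 hUm
  have hspec : P + R = U * diagonal m * Uᵀ := by
    conv_lhs => rw [hM.spectral_theorem, Unitary.conjStarAlgAut_apply]
    rfl
  have conj_mul : ∀ A B : Matrix ι ι ℝ, (U * A * Uᵀ) * (U * B * Uᵀ) = U * (A * B) * Uᵀ := by
    intro A B
    calc _ = U * A * (Uᵀ * U) * B * Uᵀ := by simp only [Matrix.mul_assoc]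
      _ = _ := by rw [h2]; simp only [Matrix.mul_assoc, Matrix.one_mul]
  have conj_inj : ∀ A B : Matrix ι ι ℝ, U * A * Uᵀ = U * B * Uᵀ → A = B := by
    intro A B h
    have := congrArg (fun Z => Uᵀ * Z * U) h
    simp only [Matrix.mul_assoc, h2, Matrix.mul_one] at this
    simpa only [← Matrix.mul_assoc, h2, Matrix.one_mul] using this
  have hsq : (P + R) * (P + R) = (P + R) + (2 : ℝ) • R := by
    rw [Matrix.add_mul, Matrix.mul_add, Matrix.mul_add, hPP, hRR, hPR, hRP, two_smul, add_assoc]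
  let b : ι → ℝ := fun i => (m i * m i - m i) / 2
  let a : ι → ℝ := fun i => m i - b i
  have hR : R = U * diagonal b * Uᵀ := by
    have h3 : (2 : ℝ) • R = (2 : ℝ) • (U * diagonal b * Uᵀ) := by
      have h4 : (2 : ℝ) • (U * diagonal b * Uᵀ) =
          U * (diagonal m * diagonal m - diagonal m) * Uᵀ := by
        rw [← Matrix.smul_mul, ← Matrix.mul_smul, ← Matrix.diagonal_smul,
          Matrix.diagonal_mul_diagonal, Matrix.diagonal_sub]
        congr 3
        ext i
        simp only [b, Pi.smul_apply, smul_eq_mul]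
        ring
      rw [h4, Matrix.mul_sub, Matrix.sub_mul, ← conj_mul, ← hspec, hsq, add_sub_cancel_left]
    exact smul_right_injective _ (two_ne_zero' ℝ) h3
  have hP : P = U * diagonal a * Uᵀ := by
    have h4 : diagonal a = diagonal m - diagonal b := by
      rw [Matrix.diagonal_sub]
    rw [h4, Matrix.mul_sub, Matrix.sub_mul, ← hspec, ← hR, add_sub_cancel_right]
  have ha : ∀ i, a i * a i = a i := by
    rw [hP, conj_mul] at hPP
    have := conj_inj _ _ hPP
    rw [Matrix.diagonal_mul_diagonal] at this
    exact congrFun (Matrix.diagonal_injective this)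
  have hb : ∀ i, b i * b i = b i := by
    rw [hR, conj_mul] at hRR
    have := conj_inj _ _ hRR
    rw [Matrix.diagonal_mul_diagonal] at this
    exact congrFun (Matrix.diagonal_injective this)
  have hab : ∀ i, a i * b i = b i := by
    rw [hR, hP, conj_mul] at hPR
    have := conj_inj _ _ hPR
    rw [Matrix.diagonal_mul_diagonal] at this
    exact congrFun (Matrix.diagonal_injective this)
  refine ⟨U, hUm, a, b, hP, hR, fun i => ?_⟩
  have hai : a i = 0 ∨ a i = 1 := by
    have := ha i
    rcases eq_or_ne (a i) 0 with h | h
    · exact Or.inl h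
    · exact Or.inr (mul_left_cancel₀ h (by rw [this, mul_one]))
  have hbi : b i = 0 ∨ b i = 1 := by
    have := hb i
    rcases eq_or_ne (b i) 0 with h | h
    · exact Or.inl h
    · exact Or.inr (mul_left_cancel₀ h (by rw [this, mul_one]))
  have := hab i
  rcases hai with h | h <;> rcases hbi with h' | h' <;>
    simp [h, h'] at this ⊢

lemma sqnorm_orthogonal_mulVec {n : ℕ} {U : Matrix (Fin n) (Fin n) ℝ}
    (hU : U ∈ Matrix.orthogonalGroup (Fin n) ℝ) (x : Fin n → ℝ) :
    sqnorm (U.mulVec x) = sqnorm x := by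
  have h : ∀ x : Fin n → ℝ, sqnorm x = x ⬝ᵥ x := fun x =>
    Finset.sum_congr rfl fun i _ => sq _
  rw [h, h, Matrix.dotProduct_mulVec, Matrix.vecMul_mulVec,
    (Matrix.mem_orthogonalGroup_iff' (Fin n) ℝ).1 hU, Matrix.vecMul_one]

lemma sqnorm_sub_conj_diagonal_mulVec {n : ℕ} {U : Matrix (Fin n) (Fin n) ℝ}
    (hU : U ∈ Matrix.orthogonalGroup (Fin n) ℝ) {b : Fin n → ℝ} (hb : ∀ i, b i = 0 ∨ b i = 1)
    (x : Fin n → ℝ) :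
    sqnorm (U.mulVec x - (U * diagonal b * Uᵀ).mulVec (U.mulVec x)) =
      ∑ i, (1 - b i) * x i ^ 2 := by
  have h : U.mulVec x - (U * diagonal b * Uᵀ).mulVec (U.mulVec x) =
      U.mulVec (x - (diagonal b).mulVec x) := by
    rw [Matrix.mulVec_mulVec, Matrix.mul_assoc, Matrix.mul_assoc,
      (Matrix.mem_orthogonalGroup_iff' (Fin n) ℝ).1 hU, Matrix.mul_one, Matrix.mulVec_sub,
      Matrix.mulVec_mulVec]
  rw [h, sqnorm_orthogonal_mulVec hU]
  refine Finset.sum_congr rfl fun i _ => ?_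
  rw [Pi.sub_apply, Matrix.mulVec_diagonal]
  rcases hb i with h | h <;> rw [h] <;> ring

lemma lintegral_exp_quadratic_pair {v : ℝ≥0} (hv : v ≠ 0) {a b : ℝ}
    (hab : (a = 1 ∧ b = 1) ∨ (a = 1 ∧ b = 0) ∨ (a = 0 ∧ b = 0)) :
    ∫⁻ z, ENNReal.ofReal (Real.exp (((1 - b) * z.2 ^ 2 - (1 - a) * (z.1 + z.2) ^ 2) / 4))
        ∂((gaussianReal 0 v).prod (gaussianReal 0 1)) =
      ENNReal.ofReal (√2 ^ (a - b) * (√(1 + v / 4))⁻¹ ^ (1 - a)) := by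
  rw [lintegral_prod _ (by fun_prop)]
  rcases hab with ⟨rfl, rfl⟩ | ⟨rfl, rfl⟩ | ⟨rfl, rfl⟩
  · simp
  · have h : ∀ x y : ℝ, ((1 - 0) * y ^ 2 - (1 - 1) * (x + y) ^ 2) / 4 = 1 / 4 * y ^ 2 := by
      intros; ring
    simp_rw [h]
    rw [lintegral_exp_mul_sq_gaussianReal_s14 one_ne_zero (by norm_num)]
    simp only [lintegral_const, measure_univ, mul_one, sub_zero, Real.rpow_one, sub_self,
      Real.rpow_zero]
    congr 1
    rw [← Real.sqrt_inv]
    norm_num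
  · have h : ∀ x y : ℝ, ENNReal.ofReal (Real.exp (((1 - 0) * y ^ 2 - (1 - 0) * (x + y) ^ 2) / 4)) =
        ENNReal.ofReal (Real.exp (-(1 / 4) * x ^ 2)) *
          ENNReal.ofReal (Real.exp (-(x / 2) * y)) := by
      intro x y
      rw [← ENNReal.ofReal_mul (Real.exp_pos _).le, ← Real.exp_add]
      congr 2
      ring
    simp_rw [h]
    have h2 : ∀ x : ℝ, ∫⁻ y, ENNReal.ofReal (Real.exp (-(1 / 4) * x ^ 2)) *
          ENNReal.ofReal (Real.exp (-(x / 2) * y)) ∂(gaussianReal 0 1) =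
        ENNReal.ofReal (Real.exp (-(1 / 8) * x ^ 2)) := by
      intro x
      rw [lintegral_const_mul _ (by fun_prop), lintegral_exp_mul_gaussianReal,
        ← ENNReal.ofReal_mul (Real.exp_pos _).le, ← Real.exp_add]
      congr 2
      simp only [NNReal.coe_one]
      ring
    simp_rw [h2]
    have hv' : (0 : ℝ) ≤ v := v.2
    rw [lintegral_exp_mul_sq_gaussianReal_s14 hv (by linarith)]
    simp only [sub_zero, sub_self, Real.rpow_zero, Real.rpow_one, one_mul]
    congr 3
    ring

/-- The exponential moment that drives the Chernoff bound for two nested projections. -/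
lemma lintegral_exp_nested_projections {n : ℕ} {P R : Matrix (Fin n) (Fin n) ℝ}
    (hPt : Pᵀ = P) (hRt : Rᵀ = R) (hPP : P * P = P) (hRR : R * R = R)
    (hPR : P * R = R) {v : ℝ≥0} (hv : v ≠ 0) :
    ∫⁻ z, ENNReal.ofReal (Real.exp ((sqnorm (z.2 - R.mulVec z.2) -
        sqnorm ((z.1 + z.2) - P.mulVec (z.1 + z.2))) / 4))
        ∂((Measure.pi fun _ : Fin n => gaussianReal 0 v).prod
          (Measure.pi fun _ : Fin n => gaussianReal 0 1)) =
      ENNReal.ofReal (√2 ^ (P.trace - R.trace) * (√(1 + v / 4))⁻¹ ^ (n - P.trace)) := by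
  obtain ⟨U, hU, a, b, rfl, rfl, hab⟩ :=
    exists_orthogonal_diagonalization_of_nested hPt hRt hPP hRR hPR
  have hrot := (map_orthogonal_mulVec_pi_gaussianReal U hU v).prod
    (map_orthogonal_mulVec_pi_gaussianReal U hU 1)
  have hma : Measurable fun z : (Fin n → ℝ) × (Fin n → ℝ) =>
      ENNReal.ofReal (Real.exp ((sqnorm (z.2 - (U * diagonal b * Uᵀ).mulVec z.2) -
        sqnorm ((z.1 + z.2) - (U * diagonal a * Uᵀ).mulVec (z.1 + z.2))) / 4)) := by
    unfold sqnorm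
    simp only [Pi.sub_apply, Matrix.mulVec, dotProduct, Pi.add_apply]
    fun_prop
  have ha : ∀ i, a i = 0 ∨ a i = 1 := fun i => by
    rcases hab i with h | h | h <;> simp [h.1]
  have hb : ∀ i, b i = 0 ∨ b i = 1 := fun i => by
    rcases hab i with h | h | h <;> simp [h.2]
  rw [← hrot.lintegral_comp hma]
  simp only [Prod.map_fst, Prod.map_snd, ← Matrix.mulVec_add]
  simp_rw [sqnorm_sub_conj_diagonal_mulVec hU ha, sqnorm_sub_conj_diagonal_mulVec hU hb]
  have hpp := measurePreserving_arrowProdEquivProdArrow ℝ ℝ (Fin n)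
    (fun _ => gaussianReal 0 v) (fun _ => gaussianReal 0 1)
  rw [← hpp.lintegral_comp (by fun_prop)]
  have hprod : ∀ x : Fin n → ℝ × ℝ, ENNReal.ofReal (Real.exp
      ((∑ i, (1 - b i) * ((MeasurableEquiv.arrowProdEquivProdArrow ℝ ℝ (Fin n)) x).2 i ^ 2 -
        ∑ i, (1 - a i) * (((MeasurableEquiv.arrowProdEquivProdArrow ℝ ℝ (Fin n)) x).1 +
          ((MeasurableEquiv.arrowProdEquivProdArrow ℝ ℝ (Fin n)) x).2) i ^ 2) / 4)) =
      ∏ i, (fun i (z : ℝ × ℝ) => ENNReal.ofReal (Real.exp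
        (((1 - b i) * z.2 ^ 2 - (1 - a i) * (z.1 + z.2) ^ 2) / 4))) i (x i) := by
    intro x
    rw [← ENNReal.ofReal_prod_of_nonneg fun _ _ => (Real.exp_pos _).le, ← Real.exp_sum,
      ← Finset.sum_div, Finset.sum_sub_distrib]
    rfl
  simp_rw [hprod]
  rw [lintegral_pi_prod_eq_prod _ (fun i (z : ℝ × ℝ) => ENNReal.ofReal (Real.exp
    (((1 - b i) * z.2 ^ 2 - (1 - a i) * (z.1 + z.2) ^ 2) / 4))) (fun i => by fun_prop)]
  simp_rw [fun i => lintegral_exp_quadratic_pair hv (hab i)]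
  have htr : ∀ c : Fin n → ℝ, (U * diagonal c * Uᵀ).trace = ∑ i, c i := by
    intro c
    rw [Matrix.trace_mul_comm, ← Matrix.mul_assoc,
      (Matrix.mem_orthogonalGroup_iff' (Fin n) ℝ).1 hU, Matrix.one_mul, Matrix.trace_diagonal]
  rw [← ENNReal.ofReal_prod_of_nonneg fun _ _ => by positivity, Finset.prod_mul_distrib,
    ← Real.rpow_sum_of_pos (by positivity), ← Real.rpow_sum_of_pos (by positivity), htr, htr,
    Finset.sum_sub_distrib, Finset.sum_sub_distrib]
  simp

lemma measurePreserving_pi_comp_injective {ι κ α : Type*} [Fintype ι] [Fintype κ]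
    [MeasurableSpace α] (μ : Measure α) [IsProbabilityMeasure μ] {f : ι → κ}
    (hf : Function.Injective f) :
    MeasurePreserving (fun x : κ → α => fun i => x (f i)) (Measure.pi fun _ : κ => μ)
      (Measure.pi fun _ : ι => μ) := by
  refine ⟨by fun_prop, ?_⟩
  have h : iIndepFun (fun k (x : κ → α) => x k) (Measure.pi fun _ : κ => μ) :=
    iIndepFun_pi (X := fun _ a => a) fun _ => by fun_prop
  have h2 := (iIndepFun_iff_map_fun_eq_pi_map
    fun i => (measurable_pi_apply (f i)).aemeasurable).1 (h.precomp hf)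
  refine h2.trans ?_
  congr 1
  ext1 i
  exact (measurePreserving_eval (fun _ : κ => μ) (f i)).map_eq

lemma pi_gaussianReal_submodule_eq_zero {κ : Type*} [Fintype κ] (S : Submodule ℝ (κ → ℝ))
    (hS : S ≠ ⊤) : (Measure.pi fun _ : κ => gaussianReal 0 1) S = 0 := by
  classical
  obtain ⟨f, hf0, hf⟩ := S.exists_le_ker_of_lt_top hS.lt_top
  let c : κ → ℝ := fun i => f fun j => if i = j then 1 else 0
  have hfc : ∀ x, f x = ∑ i, x i * c i := fun x => f.pi_apply_eq_sum_univ x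
  obtain ⟨i, hi⟩ : ∃ i, c i ≠ 0 := by
    by_contra! h
    exact hf0 (LinearMap.ext fun x => by simp [hfc, h])
  have hv : (∑ i, (c i ^ 2).toNNReal) ≠ 0 := by
    intro h
    have := (Finset.sum_eq_zero_iff.1 h) i (Finset.mem_univ i)
    rw [Real.toNNReal_eq_zero] at this
    exact hi (by nlinarith [sq_nonneg (c i)])
  have hsub : (S : Set (κ → ℝ)) ⊆ (fun x => ∑ i, x i * c i) ⁻¹' {0} := fun x hx => by
    have := hf hx
    rw [LinearMap.mem_ker, hfc] at this
    exact this
  refine measure_mono_null hsub ?_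
  rw [← Measure.map_apply (by fun_prop) (measurableSet_singleton 0), map_sum_mul_pi_gaussianReal]
  have := nullSingletonClass_gaussianReal (μ := 0) hv
  exact measure_singleton 0

lemma ae_linearIndependent_pi_gaussianReal {κ : Type*} [Fintype κ] (m : ℕ)
    (hm : m ≤ Fintype.card κ) :
    ∀ᵐ x ∂(Measure.pi fun _ : Fin m => Measure.pi fun _ : κ => gaussianReal 0 1),
      LinearIndependent ℝ x := by
  induction m with
  | zero => exact ae_of_all _ fun x => linearIndependent_empty_type
  | succ m ih =>
    have hmp := measurePreserving_piFinSuccAbove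
      (fun _ : Fin (m + 1) => Measure.pi fun _ : κ => gaussianReal 0 1) 0
    have hmeas : MeasurableSet {z : (κ → ℝ) × (Fin m → κ → ℝ) |
        LinearIndependent ℝ (Fin.cons z.1 z.2 : Fin (m + 1) → κ → ℝ)} := by
      have h := (isOpen_setOfPred_linearIndependent (𝕜 := ℝ) (E := κ → ℝ)
        (ι := Fin (m + 1))).measurableSet
      refine measurableSet_preimage (f := fun z : (κ → ℝ) × (Fin m → κ → ℝ) =>
        (Fin.cons z.1 z.2 : Fin (m + 1) → κ → ℝ)) ?_ h
      refine measurable_pi_iff.2 fun i => ?_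
      refine Fin.cases ?_ (fun j => ?_) i
      · simpa using measurable_fst
      · simp only [Fin.cons_succ]; fun_prop
    have key : ∀ᵐ z ∂((Measure.pi fun _ : κ => gaussianReal 0 1).prod
        (Measure.pi fun _ : Fin m => Measure.pi fun _ : κ => gaussianReal 0 1)),
        LinearIndependent ℝ (Fin.cons z.1 z.2 : Fin (m + 1) → κ → ℝ) := by
      rw [← Measure.prod_swap, ae_map_iff (by fun_prop) hmeas]
      refine (Measure.ae_prod_iff_ae_ae (measurable_swap hmeas)).2 ?_
      filter_upwards [ih (by omega)] with v hv
      have hne : Submodule.span ℝ (Set.range v) ≠ ⊤ := by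
        intro h
        have h1 := finrank_span_eq_card hv
        rw [h, finrank_top, Module.finrank_fintype_fun_eq_card, Fintype.card_fin] at h1
        omega
      have h0 := pi_gaussianReal_submodule_eq_zero _ hne
      rw [← compl_mem_ae_iff] at h0
      filter_upwards [h0] with x hx
      exact linearIndependent_finCons.2 ⟨hv, hx⟩
    have := hmp.quasiMeasurePreserving.ae key
    filter_upwards [this] with x hx
    convert hx using 1
    ext i : 1
    refine Fin.cases ?_ (fun j => ?_) i
    · rfl
    · rfl

lemma ae_isUnit_det_gram {n : ℕ} {κ : Type*} [Fintype κ] [DecidableEq κ]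
    (hn : Fintype.card κ ≤ n) :
    ∀ᵐ x ∂(Measure.pi fun _ : Fin n => Measure.pi fun _ : κ => gaussianReal 0 1),
      IsUnit ((Matrix.of x)ᵀ * Matrix.of x).det := by
  have hmp := measurePreserving_pi_comp_injective (Measure.pi fun _ : κ => gaussianReal 0 1)
    (Fin.castLE_injective hn)
  filter_upwards [hmp.quasiMeasurePreserving.ae (ae_linearIndependent_pi_gaussianReal
    (Fintype.card κ) le_rfl)] with x hx
  rw [← Matrix.isUnit_iff_isUnit_det, ← Matrix.mulVec_injective_iff_isUnit]
  have hrank : (Fintype.card κ) ≤ (Matrix.of x).rank := by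
    have h1 := LinearIndependent.rank_matrix
      (M := (Matrix.of x).submatrix (Fin.castLE hn) id) hx
    rw [Fintype.card_fin] at h1
    exact h1.symm.le.trans (Matrix.rank_submatrix_le _ _ _)
  rw [← Matrix.rank_transpose_mul_self, Matrix.rank] at hrank
  have hr : LinearMap.range ((Matrix.of x)ᵀ * Matrix.of x).mulVecLin = ⊤ := by
    apply Submodule.eq_top_of_finrank_eq
    refine le_antisymm (Submodule.finrank_le _) ?_
    rwa [Module.finrank_fintype_fun_eq_card]
  have := LinearMap.injective_iff_surjective.2 (LinearMap.range_eq_top.1 hr)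
  exact this

/-- The hat matrix `A (AᵀA)⁻¹ Aᵀ` of a design matrix `A`. -/
def hatMatrix {n : ℕ} {κ : Type*} [Fintype κ] [DecidableEq κ] (A : Matrix (Fin n) κ ℝ) :
    Matrix (Fin n) (Fin n) ℝ :=
  A * (Aᵀ * A)⁻¹ * Aᵀ

section hatMatrix

variable {n : ℕ} {κ : Type*} [Fintype κ] [DecidableEq κ]

lemma hatMatrix_transpose (A : Matrix (Fin n) κ ℝ) : (hatMatrix A)ᵀ = hatMatrix A := by
  simp only [hatMatrix, Matrix.transpose_mul, Matrix.transpose_nonsing_inv,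
    Matrix.transpose_transpose, Matrix.mul_assoc]

lemma hatMatrix_mul_self_left {A : Matrix (Fin n) κ ℝ} (hA : IsUnit (Aᵀ * A).det) :
    hatMatrix A * A = A := by
  rw [hatMatrix, Matrix.mul_assoc, Matrix.mul_assoc, Matrix.nonsing_inv_mul _ hA, Matrix.mul_one]

lemma hatMatrix_mul_submatrix {l : Type*} {A : Matrix (Fin n) κ ℝ}
    (hA : IsUnit (Aᵀ * A).det) (g : l → κ) :
    hatMatrix A * A.submatrix id g = A.submatrix id g := by
  have h : A.submatrix id g = A * (1 : Matrix κ κ ℝ).submatrix id g := by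
    ext i j
    simp [Matrix.mul_apply, Matrix.one_apply]
  rw [h, ← Matrix.mul_assoc, hatMatrix_mul_self_left hA]

lemma hatMatrix_mul_hatMatrix_submatrix {l : Type*} [Fintype l] [DecidableEq l]
    {A : Matrix (Fin n) κ ℝ} (hA : IsUnit (Aᵀ * A).det) (g : l → κ) :
    hatMatrix A * hatMatrix (A.submatrix id g) = hatMatrix (A.submatrix id g) := by
  conv_lhs => rw [hatMatrix.eq_def (A.submatrix id g)]
  rw [← Matrix.mul_assoc, ← Matrix.mul_assoc, hatMatrix_mul_submatrix hA]
  rfl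

lemma hatMatrix_mul_hatMatrix {A : Matrix (Fin n) κ ℝ} (hA : IsUnit (Aᵀ * A).det) :
    hatMatrix A * hatMatrix A = hatMatrix A := by
  simpa using hatMatrix_mul_hatMatrix_submatrix hA id

lemma trace_hatMatrix {A : Matrix (Fin n) κ ℝ} (hA : IsUnit (Aᵀ * A).det) :
    (hatMatrix A).trace = Fintype.card κ := by
  rw [hatMatrix, Matrix.trace_mul_comm, ← Matrix.mul_assoc, Matrix.mul_nonsing_inv _ hA,
    Matrix.trace_one]

lemma residual_add_mulVec {A : Matrix (Fin n) κ ℝ} (hA : IsUnit (Aᵀ * A).det)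
    (y : Fin n → ℝ) (c : κ → ℝ) :
    (y + A.mulVec c) - (hatMatrix A).mulVec (y + A.mulVec c) = y - (hatMatrix A).mulVec y := by
  rw [Matrix.mulVec_add, Matrix.mulVec_mulVec, hatMatrix_mul_self_left hA]
  abel

lemma sqnorm_residual_le {A : Matrix (Fin n) κ ℝ} (hA : IsUnit (Aᵀ * A).det)
    (y : Fin n → ℝ) :
    sqnorm (y - (hatMatrix A).mulVec y) ≤ sqnorm y := by
  have h : ∀ x : Fin n → ℝ, sqnorm x = x ⬝ᵥ x := fun x =>
    Finset.sum_congr rfl fun i _ => sq _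
  have h1 : (hatMatrix A).mulVec y ⬝ᵥ (hatMatrix A).mulVec y = y ⬝ᵥ (hatMatrix A).mulVec y := by
    rw [Matrix.dotProduct_mulVec, Matrix.vecMul_mulVec, hatMatrix_transpose,
      hatMatrix_mul_hatMatrix hA, Matrix.dotProduct_mulVec]
  have h2 : 0 ≤ (hatMatrix A).mulVec y ⬝ᵥ (hatMatrix A).mulVec y := by
    rw [← h]; exact Finset.sum_nonneg fun i _ => sq_nonneg _
  rw [h, h, sub_dotProduct, dotProduct_sub, dotProduct_sub, h1,
    dotProduct_comm ((hatMatrix A).mulVec y) y]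
  linarith

/-- The least-squares residual is minimal among all fits by columns of the design. -/
lemma sqnorm_residual_le_sub_mulVec {A : Matrix (Fin n) κ ℝ} (hA : IsUnit (Aᵀ * A).det)
    (y : Fin n → ℝ) (c : κ → ℝ) :
    sqnorm (y - (hatMatrix A).mulVec y) ≤ sqnorm (y - A.mulVec c) := by
  have := residual_add_mulVec hA (y - A.mulVec c) c
  rw [sub_add_cancel] at this
  rw [this]
  exact sqnorm_residual_le hA _

end hatMatrix

lemma measurable_hatMatrix_apply {n : ℕ} {κ : Type*} [Fintype κ] [DecidableEq κ] (i j : Fin n) :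
    Measurable fun x : Fin n → κ → ℝ => hatMatrix (Matrix.of x) i j := by
  have hgram : Continuous fun x : Fin n → κ → ℝ => (Matrix.of x)ᵀ * Matrix.of x := by
    have h : Continuous fun x : Fin n → κ → ℝ => Matrix.of x := continuous_id
    exact h.matrix_transpose.matrix_mul h
  have hdet := hgram.matrix_det.measurable
  have hadj : ∀ a b, Measurable fun x : Fin n → κ → ℝ =>
      ((Matrix.of x)ᵀ * Matrix.of x).adjugate a b := fun a b =>
    (hgram.matrix_adjugate.matrix_elem a b).measurable
  have hx : ∀ a b, Measurable fun x : Fin n → κ → ℝ => x a b := fun a b => by fun_prop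
  simp only [hatMatrix, Matrix.inv_def, Ring.inverse_eq_inv', Matrix.mul_apply,
    Matrix.smul_apply, smul_eq_mul, Matrix.transpose_apply, Matrix.of_apply]
  refine Finset.measurable_sum _ fun a _ => Measurable.mul ?_ (hx _ _)
  exact Finset.measurable_sum _ fun b _ => (hx _ _).mul (hdet.inv.mul (hadj _ _))

lemma measurable_sqnorm_sub_mulVec {α : Type*} [MeasurableSpace α] {n : ℕ}
    {M : α → Matrix (Fin n) (Fin n) ℝ} {y : α → Fin n → ℝ}
    (hM : ∀ i j, Measurable fun a => M a i j) (hy : Measurable y) :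
    Measurable fun a => sqnorm (y a - (M a).mulVec (y a)) := by
  simp only [sqnorm, Pi.sub_apply, Matrix.mulVec, dotProduct]
  fun_prop

/-- Splitting the rows of a Gaussian matrix into the columns in `F` and a linear combination of the
remaining columns gives independent Gaussian blocks. -/
lemma measurePreserving_columns_prod_sum (n : ℕ) {p : ℕ} (F : Finset (Fin p)) (β : Fin p → ℝ) :
    MeasurePreserving
      (fun X : Fin n → Fin p → ℝ =>
        ((fun r (j : {j // j ∈ F}) => X r j, fun r => ∑ j : {j // j ∉ F}, X r j * β j) :
          (Fin n → {j // j ∈ F} → ℝ) × (Fin n → ℝ)))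
      (Measure.pi fun _ => Measure.pi fun _ => gaussianReal 0 1)
      ((Measure.pi fun _ => Measure.pi fun _ => gaussianReal 0 1).prod
        (Measure.pi fun _ => gaussianReal 0 (∑ j : {j // j ∉ F}, (β j ^ 2).toNNReal))) := by
  have hsplit : MeasurePreserving
      (MeasurableEquiv.piEquivPiSubtypeProd (fun _ : Fin p => ℝ) fun j => j ∈ F)
      (Measure.pi fun _ => gaussianReal 0 1)
      ((Measure.pi fun _ : {j // j ∈ F} => gaussianReal 0 1).prod
        (Measure.pi fun _ : {j // j ∉ F} => gaussianReal 0 1)) := by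
    convert measurePreserving_piEquivPiSubtypeProd
      (fun _ : Fin p => gaussianReal 0 1) (fun j => j ∈ F)
  have hsum : MeasurePreserving (fun x : {j // j ∉ F} → ℝ => ∑ j, x j * β j)
      (Measure.pi fun _ => gaussianReal 0 1)
      (gaussianReal 0 (∑ j : {j // j ∉ F}, (β j ^ 2).toNNReal)) :=
    ⟨by fun_prop, map_sum_mul_pi_gaussianReal fun j : {j // j ∉ F} => β j⟩
  have hrow := ((MeasurePreserving.id (Measure.pi fun _ : {j // j ∈ F} =>
    gaussianReal 0 1)).prod hsum).comp hsplit
  have hrows := measurePreserving_pi (fun _ : Fin n => Measure.pi fun _ : Fin p =>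
    gaussianReal 0 1) _ (fun _ : Fin n => hrow)
  exact (measurePreserving_arrowProdEquivProdArrow _ _ _ _ _).comp hrows

lemma ae_isUnit_det_gram_submatrix {n : ℕ} {κ l : Type*} [Fintype κ] [Fintype l] [DecidableEq l]
    {f : l → κ} (hf : Function.Injective f) (hn : Fintype.card l ≤ n) :
    ∀ᵐ x ∂(Measure.pi fun _ : Fin n => Measure.pi fun _ : κ => gaussianReal 0 1),
      IsUnit (((Matrix.of x).submatrix id f)ᵀ * (Matrix.of x).submatrix id f).det :=
  (measurePreserving_pi _ _ fun _ : Fin n => measurePreserving_pi_comp_injective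
    (gaussianReal 0 1) hf).quasiMeasurePreserving.ae (ae_isUnit_det_gram hn)

lemma mulVec_eq_colSub_mulVec_add_sum {n p : ℕ} (X : Matrix (Fin n) (Fin p) ℝ) (F : Finset (Fin p))
    (β : Fin p → ℝ) :
    X.mulVec β = (fun r => ∑ j : {j // j ∉ F}, X r j * β j) +
      (colSub X F).mulVec fun j : {j // j ∈ F} => β j := by
  ext r
  simp only [Matrix.mulVec, dotProduct, Pi.add_apply, colSub, Matrix.submatrix_apply, id]
  rw [add_comm]
  convert (Fintype.sum_subtype_add_sum_subtype (fun j => j ∈ F) fun j => X r j * β j).symm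

/-- If `F` fits at least as well as the true support `T`, then the Chernoff exponent is
nonnegative. -/
lemma sqnorm_residual_le_of_error {n p : ℕ} {X : Matrix (Fin n) (Fin p) ℝ} {ε : Fin n → ℝ}
    {T F : Finset (Fin p)} {β : Fin p → ℝ} (hsupp : ∀ i, i ∉ T → β i = 0)
    (hXF : IsUnit ((colSub X F)ᵀ * colSub X F).det)
    (hXT : IsUnit ((colSub X T)ᵀ * colSub X T).det)
    (herr : sqnorm (X.mulVec β + ε - (proj X F).mulVec (X.mulVec β + ε)) ≤
      sqnorm (X.mulVec β + ε - (proj X T).mulVec (X.mulVec β + ε))) :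
    sqnorm ((fun r => ∑ j : {j // j ∉ F}, X r j * β j) + ε -
        (hatMatrix (colSub X F)).mulVec ((fun r => ∑ j : {j // j ∉ F}, X r j * β j) + ε)) ≤
      sqnorm (ε - (hatMatrix (colSub X (T ∩ F))).mulVec ε) := by
  have hF := residual_add_mulVec hXF ((fun r => ∑ j : {j // j ∉ F}, X r j * β j) + ε)
    (fun j : {j // j ∈ F} => β j)
  rw [add_right_comm, ← mulVec_eq_colSub_mulVec_add_sum] at hF
  have hT := residual_add_mulVec hXT ε (fun j : {j // j ∈ T} => β j)
  have h0 : (fun r => ∑ j : {j // j ∉ T}, X r j * β j) = 0 := by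
    ext r
    exact Finset.sum_eq_zero fun j _ => by rw [hsupp j j.2, mul_zero]
  have hX := mulVec_eq_colSub_mulVec_add_sum X T β
  rw [h0, zero_add] at hX
  rw [← hX, add_comm ε] at hT
  have hR : (hatMatrix (colSub X (T ∩ F))).mulVec ε = (colSub X T).mulVec
      ((((colSub X T)ᵀ * colSub X T)⁻¹ * (colSub X T)ᵀ).mulVec
        ((hatMatrix (colSub X (T ∩ F))).mulVec ε)) := by
    have h := hatMatrix_mul_hatMatrix_submatrix hXT
      (fun j : {j // j ∈ T ∩ F} => (⟨j, (Finset.mem_inter.1 j.2).1⟩ : {j // j ∈ T}))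
    rw [Matrix.mulVec_mulVec, Matrix.mulVec_mulVec, ← Matrix.mul_assoc]
    exact congrArg (fun M => Matrix.mulVec M ε) h.symm
  calc _ = _ := congrArg sqnorm hF.symm
    _ ≤ _ := herr
    _ = _ := congrArg sqnorm hT
    _ ≤ _ := by
      rw [hR]
      exact sqnorm_residual_le_sub_mulVec hXT _ _

/-- Chernoff bound for the probability that a wrong pattern `F` fits at least as well as `T`. -/
lemma jointGaussian_error_le {n p : ℕ} {T F : Finset (Fin p)} {β : Fin p → ℝ}
    (hsupp : ∀ i, i ∉ T → β i = 0) (hFT : F.card = T.card) (hn : T.card ≤ n)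
    {v : ℝ≥0} (hv : v = ∑ j : {j // j ∉ F}, (β j ^ 2).toNNReal) (hv0 : v ≠ 0) :
    jointGaussian n p
      {ω | sqnorm ((Matrix.of ω.1).mulVec β + ω.2 -
          (proj (Matrix.of ω.1) F).mulVec ((Matrix.of ω.1).mulVec β + ω.2)) ≤
        sqnorm ((Matrix.of ω.1).mulVec β + ω.2 -
          (proj (Matrix.of ω.1) T).mulVec ((Matrix.of ω.1).mulVec β + ω.2))} ≤
      ENNReal.ofReal (√2 ^ ((F.card : ℝ) - (T ∩ F).card) * (√(1 + v / 4))⁻¹ ^ ((n : ℝ) - F.card)) := by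
  let g : {j // j ∈ T ∩ F} → {j // j ∈ F} := fun j => ⟨j, (Finset.mem_inter.1 j.2).2⟩
  have hg : Function.Injective g := fun a b h => by
    simpa only [g, Subtype.mk.injEq, Subtype.val_inj] using h
  let G : (Fin n → {j // j ∈ F} → ℝ) × ((Fin n → ℝ) × (Fin n → ℝ)) → ℝ≥0∞ := fun q =>
    ENNReal.ofReal (Real.exp ((sqnorm (q.2.2 -
      (hatMatrix ((Matrix.of q.1).submatrix id g)).mulVec q.2.2) -
      sqnorm ((q.2.1 + q.2.2) - (hatMatrix (Matrix.of q.1)).mulVec (q.2.1 + q.2.2))) / 4))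
  have hGm : Measurable G := by
    have h1 : Measurable fun q : (Fin n → {j // j ∈ F} → ℝ) × ((Fin n → ℝ) × (Fin n → ℝ)) =>
        sqnorm (q.2.2 - (hatMatrix ((Matrix.of q.1).submatrix id g)).mulVec q.2.2) := by
      refine measurable_sqnorm_sub_mulVec (fun i j => ?_) (by fun_prop)
      exact (measurable_hatMatrix_apply i j).comp
        (f := fun (q : (Fin n → {j // j ∈ F} → ℝ) × ((Fin n → ℝ) × (Fin n → ℝ))) r a =>
          q.1 r (g a)) (by fun_prop)
    have h2 : Measurable fun q : (Fin n → {j // j ∈ F} → ℝ) × ((Fin n → ℝ) × (Fin n → ℝ)) =>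
        sqnorm ((q.2.1 + q.2.2) - (hatMatrix (Matrix.of q.1)).mulVec (q.2.1 + q.2.2)) :=
      measurable_sqnorm_sub_mulVec (fun i j => (measurable_hatMatrix_apply i j).comp
        measurable_fst) (by fun_prop)
    exact (Real.measurable_exp.comp ((h1.sub h2).div_const 4)).ennreal_ofReal
  have hlaw := (measurePreserving_prodAssoc _ _ _).comp
    ((measurePreserving_columns_prod_sum n F β).prod
      (MeasurePreserving.id (Measure.pi fun _ : Fin n => gaussianReal 0 1)))
  rw [← hv] at hlaw
  have hcard : ∀ S : Finset (Fin p), Fintype.card {j // j ∈ S} = S.card := fun S =>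
    Fintype.card_coe S
  have hTF : Fintype.card {j // j ∈ T ∩ F} ≤ n :=
    (hcard _).trans_le ((Finset.card_le_card Finset.inter_subset_left).trans hn)
  have hF : Fintype.card {j // j ∈ F} ≤ n := (hcard _).trans_le (hFT.trans_le hn)
  have hT : Fintype.card {j // j ∈ T} ≤ n := (hcard _).trans_le hn
  have haeF := Measure.quasiMeasurePreserving_fst (ν := Measure.pi fun _ : Fin n => gaussianReal 0 1)
    |>.ae (ae_isUnit_det_gram_submatrix (n := n) (κ := Fin p) (l := {j // j ∈ F})
      Subtype.val_injective hF)
  have haeT := Measure.quasiMeasurePreserving_fst (ν := Measure.pi fun _ : Fin n => gaussianReal 0 1)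
    |>.ae (ae_isUnit_det_gram_submatrix (n := n) (κ := Fin p) (l := {j // j ∈ T})
      Subtype.val_injective hT)
  have hle : ∀ᵐ ω ∂jointGaussian n p,
      (sqnorm ((Matrix.of ω.1).mulVec β + ω.2 -
          (proj (Matrix.of ω.1) F).mulVec ((Matrix.of ω.1).mulVec β + ω.2)) ≤
        sqnorm ((Matrix.of ω.1).mulVec β + ω.2 -
          (proj (Matrix.of ω.1) T).mulVec ((Matrix.of ω.1).mulVec β + ω.2))) →
      1 ≤ G ((fun r j => ω.1 r j, ((fun r => ∑ j : {j // j ∉ F}, ω.1 r j * β j), ω.2))) := by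
    filter_upwards [haeF, haeT] with ω h1 h2 herr
    have h := sqnorm_residual_le_of_error hsupp h1 h2 herr
    rw [← ENNReal.ofReal_one]
    refine ENNReal.ofReal_le_ofReal (Real.one_le_exp ?_)
    exact div_nonneg (sub_nonneg.2 h) (by norm_num)
  calc _ ≤ jointGaussian n p {ω | 1 ≤ G ((fun r j => ω.1 r j,
        ((fun r => ∑ j : {j // j ∉ F}, ω.1 r j * β j), ω.2)))} := measure_mono_ae hle
    _ ≤ ∫⁻ ω, G ((fun r j => ω.1 r j,
        ((fun r => ∑ j : {j // j ∉ F}, ω.1 r j * β j), ω.2))) ∂jointGaussian n p := by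
      have h := mul_meas_ge_le_lintegral₀ (μ := jointGaussian n p)
        (hGm.comp hlaw.measurable).aemeasurable 1
      rw [one_mul] at h
      exact h
    _ = ∫⁻ q, G q ∂((Measure.pi fun _ => Measure.pi fun _ => gaussianReal 0 1).prod
          ((Measure.pi fun _ => gaussianReal 0 v).prod
            (Measure.pi fun _ => gaussianReal 0 1))) := hlaw.lintegral_comp hGm
    _ = ∫⁻ A, (∫⁻ z, G (A, z) ∂((Measure.pi fun _ => gaussianReal 0 v).prod
            (Measure.pi fun _ => gaussianReal 0 1)))
          ∂(Measure.pi fun _ => Measure.pi fun _ => gaussianReal 0 1) :=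
      lintegral_prod _ hGm.aemeasurable
    _ = ∫⁻ A : Fin n → {j // j ∈ F} → ℝ, ENNReal.ofReal
          (√2 ^ ((F.card : ℝ) - (T ∩ F).card) * (√(1 + v / 4))⁻¹ ^ ((n : ℝ) - F.card))
          ∂(Measure.pi fun _ => Measure.pi fun _ => gaussianReal 0 1) := by
      refine lintegral_congr_ae ?_
      filter_upwards [ae_isUnit_det_gram hF, ae_isUnit_det_gram_submatrix hg hTF] with A hA hAg
      have h := lintegral_exp_nested_projections (hatMatrix_transpose (Matrix.of A))
        (hatMatrix_transpose ((Matrix.of A).submatrix id g)) (hatMatrix_mul_hatMatrix hA)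
        (hatMatrix_mul_hatMatrix hAg) (hatMatrix_mul_hatMatrix_submatrix hA g) hv0
      rw [trace_hatMatrix hA, trace_hatMatrix hAg, hcard, hcard] at h
      exact h
    _ = _ := by simp

lemma half_lt_log_two : 1 / 2 < Real.log 2 := by
  linarith [Real.log_two_gt_d9]

lemma log_one_add_le_four_mul_log {y : ℝ} (hy : 0 ≤ y) :
    Real.log (1 + y) ≤ 4 * Real.log (1 + y / 4) := by
  have h := one_add_mul_le_pow (a := y / 4) (by linarith) 4
  calc Real.log (1 + y) ≤ Real.log ((1 + y / 4) ^ 4) :=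
        Real.log_le_log (by linarith) (by push_cast at h; linarith)
    _ = 4 * Real.log (1 + y / 4) := by rw [Real.log_pow]; norm_num

lemma mul_log_one_add_le_two_mul_log {d x : ℝ} (hd : 0 ≤ d) (hx : 0 ≤ x) (hdx : d * x ≤ 1) :
    d * Real.log (1 + x) ≤ 2 * Real.log (1 + d * x) := by
  have h0 : 0 ≤ d * x := mul_nonneg hd hx
  have h1 : Real.log (1 + x) ≤ x := by
    linarith [Real.log_le_sub_one_of_pos (show 0 < 1 + x by linarith)]
  have h2 := Real.le_log_one_add_of_nonneg h0
  have h3 : d * x / 2 ≤ 2 * (d * x) / (d * x + 2) := by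
    rw [le_div_iff₀ (by linarith)]
    nlinarith
  nlinarith [mul_le_mul_of_nonneg_left h1 hd]

lemma sq_one_add_two_mul_log_le {s : ℝ} (hs : 1 ≤ s) : (1 + 2 * Real.log s) ^ 2 ≤ 16 * s := by
  have h0 : 0 ≤ Real.log s := Real.log_nonneg hs
  have hs0 : 0 < √s := Real.sqrt_pos.2 (by linarith)
  have h1 := Real.log_le_sub_one_of_pos hs0
  rw [Real.log_sqrt (by linarith)] at h1
  have h2 := Real.sq_sqrt (show 0 ≤ s by linarith)
  calc (1 + 2 * Real.log s) ^ 2 ≤ (4 * √s) ^ 2 := by gcongr; linarith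
    _ = 16 * s := by rw [mul_pow, h2]; norm_num

/-- In the strong-signal regime the sample-size requirement for `d = k` controls all `d ≤ k`. -/
lemma mul_log_div_le_of_one_le {d k p x n C : ℝ} (hd : 0 < d) (hdk : d ≤ k) (hkp : 2 * k < p)
    (hn : 0 ≤ n) (hC : 0 ≤ C) (hdx : 1 ≤ d * x)
    (h : C * (k * Real.log (p / k)) ≤ n * Real.log (1 + k * x)) :
    C * (d * Real.log (p / d)) ≤ 16 * (n * Real.log (1 + d * x)) := by
  have hk : 0 < k := hd.trans_le hdk
  have hlog2 := half_lt_log_two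
  set s := k / d with hs
  have hs1 : 1 ≤ s := (one_le_div hd).2 hdk
  have hks : k = s * d := by rw [hs]; field_simp
  set u := Real.log s with hu
  have hu0 : 0 ≤ u := Real.log_nonneg hs1
  set L := Real.log (1 + d * x) with hL
  have hL2 : 1 / 2 ≤ L := hlog2.le.trans (Real.log_le_log (by norm_num) (by linarith))
  set q := Real.log (p / k) with hq
  have hq2 : 1 / 2 ≤ q := hlog2.le.trans (Real.log_le_log (by norm_num)
    ((le_div_iff₀ hk).2 hkp.le))
  have hpd : Real.log (p / d) = q + u := by
    rw [hq, hu, ← Real.log_mul (div_pos (by linarith) hk).ne' (by linarith), hs]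
    congr 1
    field_simp
  have hkx : Real.log (1 + k * x) ≤ u + L := by
    rw [hu, hL, ← Real.log_mul (by linarith) (by linarith)]
    refine Real.log_le_log (by rw [hks, mul_assoc]; nlinarith) ?_
    rw [hks]
    nlinarith
  have h1 : Real.log (1 + k * x) ≤ (1 + 2 * u) * L := by nlinarith
  have h2 : d * (q + u) ≤ d * (q * (1 + 2 * u)) := by
    refine mul_le_mul_of_nonneg_left ?_ hd.le
    nlinarith
  rw [hpd]
  have hsq := sq_one_add_two_mul_log_le hs1
  rw [← hu] at hsq
  have hs0 : 0 < s := by linarith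
  refine le_of_mul_le_mul_left ?_ hs0
  have hu1 : 0 ≤ 1 + 2 * u := by linarith
  calc s * (C * (d * (q + u))) ≤ s * (C * (d * (q * (1 + 2 * u)))) := by gcongr
    _ = (C * (k * q)) * (1 + 2 * u) := by rw [hks]; ring
    _ ≤ (n * Real.log (1 + k * x)) * (1 + 2 * u) := by gcongr
    _ ≤ (n * ((1 + 2 * u) * L)) * (1 + 2 * u) := by gcongr
    _ = (n * L) * (1 + 2 * u) ^ 2 := by ring
    _ ≤ (n * L) * (16 * s) := by gcongr
    _ = s * (16 * (n * L)) := by ring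

/-- The sample-size condition makes the Chernoff exponent dominate the entropy of the patterns at
distance `d` from the true support. -/
lemma entropy_le_exponent {d k p x n : ℝ} (hd : 1 ≤ d) (hdk : d ≤ k) (hkp : 2 * k < p)
    (hp : 4 ≤ p) (hx : 0 ≤ x) (hnk : 2 * k ≤ n)
    (h1 : 4000 * Real.log (p - k) ≤ n * Real.log (1 + x))
    (h2 : 4000 * (k * Real.log (p / k)) ≤ n * Real.log (1 + k * x)) :
    2 * (d * (1 + Real.log (p / d))) + d / 2 * Real.log 2 + 3 * Real.log p ≤
      (n - k) / 2 * Real.log (1 + d * x / 4) := by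
  have hlog2 := half_lt_log_two
  have hlog2' : Real.log 2 < 1 := by linarith [Real.log_two_lt_d9]
  have hdx : 0 ≤ d * x := by positivity
  have hn : 0 ≤ n := by linarith
  have hq : Real.log 2 ≤ Real.log (p / d) := Real.log_le_log (by norm_num)
    ((le_div_iff₀ (by linarith)).2 (by linarith))
  have hpk : Real.log p ≤ 2 * Real.log (p - k) := by
    have : Real.log p ≤ Real.log ((p - k) ^ 2) :=
      Real.log_le_log (by linarith) (by nlinarith)
    rwa [Real.log_pow, Nat.cast_ofNat] at this
  have hpd : Real.log (p / d) ≤ Real.log p :=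
    Real.log_le_log (by positivity) (div_le_self (by linarith) hd)
  have hL := log_one_add_le_four_mul_log hdx
  have hL0 : 0 ≤ Real.log (1 + d * x) := Real.log_nonneg (by linarith)
  have hrhs : n * Real.log (1 + d * x) ≤ 16 * ((n - k) / 2 * Real.log (1 + d * x / 4)) := by
    nlinarith
  have hD : d ≤ 2 * (d * Real.log (p / d)) := by nlinarith
  have hlhs : 2 * (d * (1 + Real.log (p / d))) + d / 2 * Real.log 2 + 3 * Real.log p ≤
      7 * (d * Real.log (p / d)) + 3 * Real.log p := by nlinarith
  suffices h : 16 * (7 * (d * Real.log (p / d)) + 3 * Real.log p) ≤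
      n * Real.log (1 + d * x) by linarith
  rcases le_total (d * x) 1 with hle | hge
  · have h3 := mul_log_one_add_le_two_mul_log (by linarith) hx hle
    have h4 : d * (2000 * Real.log p) ≤ d * (n * Real.log (1 + x)) :=
      mul_le_mul_of_nonneg_left (by linarith) (by linarith)
    have h5 : d * Real.log (p / d) ≤ d * Real.log p := by gcongr
    have h6 : Real.log p ≤ d * Real.log p := le_mul_of_one_le_left (by linarith) hd
    nlinarith [mul_le_mul_of_nonneg_left h3 hn]
  · have h3 := mul_log_div_le_of_one_le (by linarith) hdk hkp hn (by norm_num) hge h2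
    have h4 : n * Real.log (1 + x) ≤ n * Real.log (1 + d * x) := by
      refine mul_le_mul_of_nonneg_left (Real.log_le_log (by linarith) ?_) hn
      nlinarith
    linarith

lemma choose_le_exp {p d : ℕ} (hd : 0 < d) (hp : 0 < p) :
    (p.choose d : ℝ) ≤ Real.exp (d * (1 + Real.log (p / d))) := by
  have hd' : (0 : ℝ) < d := by exact_mod_cast hd
  have hp' : (0 : ℝ) < p := by exact_mod_cast hp
  have h1 : (p.choose d : ℝ) ≤ (p : ℝ) ^ d / d.factorial := Nat.choose_le_pow_div d p
  have h2 := Real.pow_div_factorial_le_exp (d : ℝ) hd'.le d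
  have h3 : Real.exp (d * (1 + Real.log (p / d))) = Real.exp d * (p / d : ℝ) ^ d := by
    rw [mul_add, mul_one, Real.exp_add, ← Real.log_pow, Real.exp_log (by positivity)]
  rw [h3]
  refine h1.trans ?_
  calc (p : ℝ) ^ d / d.factorial = (d : ℝ) ^ d / d.factorial * (p / d : ℝ) ^ d := by
        rw [div_pow]
        field_simp
    _ ≤ _ := by gcongr

lemma choose_sq_mul_chernoff_le {n k p d : ℕ} {x v : ℝ} (hd : 1 ≤ d) (hdk : d ≤ k)
    (hkp : 2 * k < p) (hp : 4 ≤ p) (hx : 0 ≤ x) (hnk : (2 * k : ℝ) ≤ n)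
    (h1 : 4000 * Real.log ((p : ℝ) - k) ≤ n * Real.log (1 + x))
    (h2 : 4000 * (k * Real.log ((p : ℝ) / k)) ≤ n * Real.log (1 + k * x))
    (hv : d * x ≤ v) :
    (p.choose d : ℝ) ^ 2 * (√2 ^ (d : ℝ) * (√(1 + v / 4))⁻¹ ^ ((n : ℝ) - k)) ≤
      ((p : ℝ) ^ 3)⁻¹ := by
  have hp0 : (0 : ℝ) < p := by exact_mod_cast (by omega : 0 < p)
  have hdx : 0 ≤ d * x := by positivity
  have hk0 : (0 : ℝ) ≤ k := by positivity
  have hE := entropy_le_exponent (d := d) (k := k) (p := p) (x := x) (n := n)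
    (by exact_mod_cast hd) (by exact_mod_cast hdk) (by exact_mod_cast hkp)
    (by exact_mod_cast hp) hx hnk h1 h2
  have hs2 : √2 ^ (d : ℝ) = Real.exp (d / 2 * Real.log 2) := by
    rw [Real.rpow_def_of_pos (by positivity), Real.log_sqrt (by norm_num)]
    ring_nf
  have hsv : (√(1 + v / 4))⁻¹ ^ ((n : ℝ) - k) ≤
      Real.exp (-((n - k) / 2 * Real.log (1 + d * x / 4))) := by
    calc (√(1 + v / 4))⁻¹ ^ ((n : ℝ) - k) ≤ (√(1 + d * x / 4))⁻¹ ^ ((n : ℝ) - k) := by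
          have : 0 < √(1 + d * x / 4) := Real.sqrt_pos.2 (by linarith)
          refine Real.rpow_le_rpow (by positivity) ?_ (by linarith)
          gcongr
      _ = _ := by
          rw [Real.rpow_def_of_pos (inv_pos.2 (Real.sqrt_pos.2 (by linarith))), Real.log_inv,
            Real.log_sqrt (by linarith)]
          ring_nf
  have hc := choose_le_exp (p := p) (d := d) (by omega) (by omega)
  have hp3 : ((p : ℝ) ^ 3)⁻¹ = Real.exp (-(3 * Real.log p)) := by
    rw [Real.exp_neg, mul_comm, Real.exp_mul, Real.exp_log hp0]
    norm_num
  rw [hs2, hp3]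
  calc _ ≤ Real.exp (d * (1 + Real.log (p / d))) ^ 2 * (Real.exp (d / 2 * Real.log 2) *
        Real.exp (-((n - k) / 2 * Real.log (1 + d * x / 4)))) := by gcongr
    _ = Real.exp (2 * (d * (1 + Real.log (p / d))) + d / 2 * Real.log 2 -
        (n - k) / 2 * Real.log (1 + d * x / 4)) := by
        rw [← Real.exp_nat_mul, ← Real.exp_add, ← Real.exp_add]
        push_cast
        ring_nf
    _ ≤ _ := Real.exp_le_exp.2 (by linarith)

lemma card_filter_card_sdiff_le {α : Type*} [Fintype α] [DecidableEq α] (T : Finset α) (d : ℕ) :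
    (Finset.univ.filter fun F : Finset α => F.card = T.card ∧ (T \ F).card = d).card ≤
      (Fintype.card α).choose d ^ 2 := by
  have h : (Finset.univ.filter fun F : Finset α => F.card = T.card ∧ (T \ F).card = d).card ≤
      (Finset.powersetCard d (Finset.univ : Finset α) ×ˢ
        Finset.powersetCard d (Finset.univ : Finset α)).card := by
    refine Finset.card_le_card_of_injOn (fun F => (T \ F, F \ T)) (fun F hF => ?_) ?_
    · obtain ⟨h1, h2⟩ : F.card = T.card ∧ (T \ F).card = d := by simpa using hF
      have h3 : (F \ T).card = d := (Finset.card_sdiff_comm h1).trans h2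
      simp [h2, h3]
    · intro F _ F' _ h
      obtain ⟨h1, h2⟩ := Prod.ext_iff.1 h
      ext a
      have h3 := Finset.ext_iff.1 h1 a
      have h4 := Finset.ext_iff.1 h2 a
      simp only [Finset.mem_sdiff] at h3 h4
      tauto
  simpa [Finset.card_product, Finset.card_powersetCard, sq] using h

lemma jointGaussian_error_le_inv_choose_sq {n k p : ℕ} {T F : Finset (Fin p)} {β : Fin p → ℝ}
    {b : ℝ} (hT : T.card = k) (hF : F.card = k) (hne : F ≠ T) (hsupp : ∀ i, i ∉ T → β i = 0)
    (hb : 0 < b) (hβ : ∀ i ∈ T, b ≤ |β i|) (hkp : 2 * k < p) (hp : 4 ≤ p) (hnk : (2 * k : ℝ) ≤ n)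
    (h1 : 4000 * Real.log ((p : ℝ) - k) ≤ n * Real.log (1 + b ^ 2))
    (h2 : 4000 * (k * Real.log ((p : ℝ) / k)) ≤ n * Real.log (1 + k * b ^ 2)) :
    jointGaussian n p
      {ω | sqnorm ((Matrix.of ω.1).mulVec β + ω.2 -
          (proj (Matrix.of ω.1) F).mulVec ((Matrix.of ω.1).mulVec β + ω.2)) ≤
        sqnorm ((Matrix.of ω.1).mulVec β + ω.2 -
          (proj (Matrix.of ω.1) T).mulVec ((Matrix.of ω.1).mulVec β + ω.2))} ≤
      ENNReal.ofReal (((p.choose (T \ F).card : ℝ) ^ 2)⁻¹ * ((p : ℝ) ^ 3)⁻¹) := by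
  have hd : 1 ≤ (T \ F).card := by
    rw [Nat.one_le_iff_ne_zero, Finset.card_ne_zero, Finset.sdiff_nonempty]
    exact fun h => hne (Finset.eq_of_subset_of_card_le h (hF.trans hT.symm).le).symm
  have hdk : (T \ F).card ≤ k := hT ▸ Finset.card_le_card Finset.sdiff_subset
  have hcard : ((F.card : ℝ) - (T ∩ F).card) = (T \ F).card := by
    have := Finset.card_sdiff_add_card_inter T F
    rw [hT, ← hF] at this
    rw [← this]
    push_cast
    ring
  set v : ℝ≥0 := ∑ j : {j // j ∉ F}, (β j ^ 2).toNNReal with hv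
  have hvd : ((T \ F).card : ℝ) * b ^ 2 ≤ v := by
    have hv' : (v : ℝ) = ∑ j ∈ Finset.univ.filter (· ∉ F), β j ^ 2 := by
      rw [hv, NNReal.coe_sum, ← Finset.sum_subtype (p := (· ∉ F))
        (Finset.univ.filter (· ∉ F)) (by simp) (fun j => ((β j ^ 2).toNNReal : ℝ))]
      exact Finset.sum_congr rfl fun j _ => Real.coe_toNNReal _ (sq_nonneg _)
    rw [hv', ← nsmul_eq_mul]
    refine (Finset.card_nsmul_le_sum (T \ F) (fun j => β j ^ 2) (b ^ 2) fun j hj => ?_).trans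
      (Finset.sum_le_sum_of_subset_of_nonneg (fun j hj => ?_) fun j _ _ => sq_nonneg _)
    · rw [← sq_abs (β j)]
      have := hβ j (Finset.mem_sdiff.1 hj).1
      gcongr
    · simpa using (Finset.mem_sdiff.1 hj).2
  have hv0 : v ≠ 0 := by
    intro h
    rw [h, NNReal.coe_zero] at hvd
    have : (0 : ℝ) < (T \ F).card := by exact_mod_cast hd
    exact absurd hvd (not_le.2 (by positivity))
  have hn : T.card ≤ n := by
    have : (T.card : ℝ) ≤ n := by
      rw [hT]
      have : (0 : ℝ) ≤ k := by positivity
      linarith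
    exact_mod_cast this
  refine (jointGaussian_error_le hsupp (hF.trans hT.symm) hn hv hv0).trans
    (ENNReal.ofReal_le_ofReal ?_)
  have hc : (0 : ℝ) < p.choose (T \ F).card := by
    exact_mod_cast Nat.choose_pos (by omega)
  rw [hcard, hF, ← div_eq_inv_mul, le_div_iff₀' (by positivity)]
  exact choose_sq_mul_chernoff_le hd hdk hkp hp (sq_nonneg b) hnk h1 h2 hvd

lemma errP_le_inv_sq {n k p : ℕ} {T : Finset (Fin p)} {β : Fin p → ℝ}
    {b : ℝ} (hT : T.card = k) (hsupp : ∀ i, i ∉ T → β i = 0)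
    (hb : 0 < b) (hβ : ∀ i ∈ T, b ≤ |β i|) (hkp : 2 * k < p) (hp : 4 ≤ p) (hnk : (2 * k : ℝ) ≤ n)
    (h1 : 4000 * Real.log ((p : ℝ) - k) ≤ n * Real.log (1 + b ^ 2))
    (h2 : 4000 * (k * Real.log ((p : ℝ) / k)) ≤ n * Real.log (1 + k * b ^ 2)) :
    errP n k β T ≤ ENNReal.ofReal (((p : ℝ) ^ 2)⁻¹) := by
  have hp0 : (0 : ℝ) < p := by exact_mod_cast (by omega : 0 < p)
  let E : Finset (Fin p) → Set ((Fin n → Fin p → ℝ) × (Fin n → ℝ)) := fun F =>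
    {ω | sqnorm ((Matrix.of ω.1).mulVec β + ω.2 -
          (proj (Matrix.of ω.1) F).mulVec ((Matrix.of ω.1).mulVec β + ω.2)) ≤
        sqnorm ((Matrix.of ω.1).mulVec β + ω.2 -
          (proj (Matrix.of ω.1) T).mulVec ((Matrix.of ω.1).mulVec β + ω.2))}
  let S : Finset (Finset (Fin p)) := Finset.univ.filter fun F => F.card = k ∧ F ≠ T
  have hmaps : ∀ F ∈ S, (T \ F).card ∈ Finset.range p := fun F _ => by
    rw [Finset.mem_range]
    exact (Finset.card_le_card Finset.sdiff_subset).trans_lt (by omega)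
  have hfib : ∀ d ∈ Finset.range p, ∑ F ∈ S with (T \ F).card = d,
      ((p.choose (T \ F).card : ℝ) ^ 2)⁻¹ * ((p : ℝ) ^ 3)⁻¹ ≤ ((p : ℝ) ^ 3)⁻¹ := fun d hd => by
    have hc : (0 : ℝ) < p.choose d := by
      exact_mod_cast Nat.choose_pos (Finset.mem_range.1 hd).le
    have hcard : ((S.filter fun F => (T \ F).card = d).card : ℝ) ≤ (p.choose d : ℝ) ^ 2 := by
      have h := card_filter_card_sdiff_le T d
      rw [Fintype.card_fin] at h
      have hle : (S.filter fun F => (T \ F).card = d).card ≤ p.choose d ^ 2 := by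
        refine (Finset.card_le_card fun F hF => ?_).trans h
        simp only [S, Finset.mem_filter, Finset.mem_univ, true_and] at hF ⊢
        exact ⟨hF.1.1.trans hT.symm, hF.2⟩
      exact_mod_cast hle
    calc ∑ F ∈ S with (T \ F).card = d, ((p.choose (T \ F).card : ℝ) ^ 2)⁻¹ * ((p : ℝ) ^ 3)⁻¹
        = ∑ F ∈ S with (T \ F).card = d, ((p.choose d : ℝ) ^ 2)⁻¹ * ((p : ℝ) ^ 3)⁻¹ :=
          Finset.sum_congr rfl fun F hF => by rw [(Finset.mem_filter.1 hF).2]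
      _ = (S.filter fun F => (T \ F).card = d).card *
          (((p.choose d : ℝ) ^ 2)⁻¹ * ((p : ℝ) ^ 3)⁻¹) := by rw [Finset.sum_const, nsmul_eq_mul]
      _ ≤ (p.choose d : ℝ) ^ 2 * (((p.choose d : ℝ) ^ 2)⁻¹ * ((p : ℝ) ^ 3)⁻¹) := by gcongr
      _ = ((p : ℝ) ^ 3)⁻¹ := by field_simp
  calc errP n k β T ≤ jointGaussian n p (⋃ F ∈ S, E F) := by
        refine measure_mono fun ω ⟨F, hF, hne, h⟩ => ?_
        exact Set.mem_biUnion (show F ∈ S by simp [S, hF, hne]) h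
    _ ≤ ∑ F ∈ S, jointGaussian n p (E F) := measure_biUnion_finset_le S E
    _ ≤ ∑ F ∈ S, ENNReal.ofReal (((p.choose (T \ F).card : ℝ) ^ 2)⁻¹ * ((p : ℝ) ^ 3)⁻¹) := by
        refine Finset.sum_le_sum fun F hF => ?_
        obtain ⟨hFk, hne⟩ := (Finset.mem_filter.1 hF).2
        exact jointGaussian_error_le_inv_choose_sq hT hFk hne hsupp hb hβ hkp hp hnk h1 h2
    _ = ENNReal.ofReal (∑ F ∈ S, ((p.choose (T \ F).card : ℝ) ^ 2)⁻¹ * ((p : ℝ) ^ 3)⁻¹) :=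
        (ENNReal.ofReal_sum_of_nonneg fun F _ => by positivity).symm
    _ ≤ ENNReal.ofReal (((p : ℝ) ^ 2)⁻¹) := by
        refine ENNReal.ofReal_le_ofReal ?_
        rw [← Finset.sum_fiberwise_of_maps_to hmaps]
        refine (Finset.sum_le_sum hfib).trans (le_of_eq ?_)
        rw [Finset.sum_const, Finset.card_range, nsmul_eq_mul]
        field_simp

instance isProbabilityMeasure_jointGaussian (n p : ℕ) :
    IsProbabilityMeasure (jointGaussian n p) := by
  unfold jointGaussian
  infer_instance

end

/-- **Corollary 3.** For the sequence of models
`y⁽ᵖ⁾ = X⁽ᵖ⁾β⁽ᵖ⁾ + ε⁽ᵖ⁾` with i.i.d. Gaussian `X⁽ᵖ⁾`, under the condition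
`(n(p)-k(p))β_min(p)² > 4(1 + k(p)β_min(p)²)²/(k(p)β_min(p)²)`, there is a
constant `C*` such that if
`n(p) > C* max{log(p-k)/log(1+β_min²), k log(p/k)/log(1+kβ_min²), k}`
for all large `p`, then the error probabilities are summable, tend to `0`,
and (by Borel–Cantelli, on any common probability space carrying events of
these probabilities) almost surely the decoder is exact for all large `p`. -/
theorem sufficient_conditions_for_exact_recovery
    (n k : ℕ → ℕ) (T : ∀ p, Finset (Fin p)) (β : ∀ p, Fin p → ℝ)
    (bmin : ℕ → ℝ)
    (hT : ∀ p, (T p).card = k p)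
    (hsupp : ∀ p, ∀ i, i ∉ T p → β p i = 0)
    (hk : ∀ᶠ p in Filter.atTop, 1 ≤ k p ∧ 2 * k p < p)
    (hbmin : ∀ᶠ p in Filter.atTop,
      IsLeast ((fun i => |β p i|) '' (T p : Set (Fin p))) (bmin p))
    (hcond : ∀ᶠ p in Filter.atTop,
      ((n p : ℝ) - k p) * bmin p ^ 2 >
        4 * (1 + k p * bmin p ^ 2) ^ 2 / (k p * bmin p ^ 2)) :
    ∃ Cstar : ℝ,
      (∀ᶠ p in Filter.atTop, (n p : ℝ) > Cstar * max
          (Real.log ((p : ℝ) - k p) / Real.log (1 + bmin p ^ 2))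
          (max ((k p : ℝ) * Real.log ((p : ℝ) / k p) /
              Real.log (1 + k p * bmin p ^ 2))
            (k p : ℝ))) →
        Summable (fun p => (errP (n p) (k p) (β p) (T p)).toReal) ∧
        Filter.Tendsto (fun p => errP (n p) (k p) (β p) (T p))
          Filter.atTop (nhds 0) ∧
        ∀ (Ω : Type) (_ : MeasurableSpace Ω) (P : Measure Ω),
          IsProbabilityMeasure P →
          ∀ A : ℕ → Set Ω,
            (∀ p, P (A p) = errP (n p) (k p) (β p) (T p)) →
            ∀ᵐ ω ∂P, ∀ᶠ p in Filter.atTop, ω ∉ A p := by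
  refine ⟨4000, fun hn => ?_⟩
  have hbound : ∀ᶠ p : ℕ in Filter.atTop,
      errP (n p) (k p) (β p) (T p) ≤ ENNReal.ofReal (((p : ℝ) ^ 2)⁻¹) := by
    filter_upwards [hk, hbmin, hcond, hn, Filter.eventually_ge_atTop 4]
      with p ⟨hk1, hkp⟩ hb hc hnp hp
    have hb0 : 0 < bmin p := by
      obtain ⟨i, -, hi⟩ := hb.1
      refine lt_of_le_of_ne (hi ▸ abs_nonneg _) fun h => ?_
      simp [← h] at hc
    have hk0 : (0 : ℝ) < k p := by exact_mod_cast hk1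
    have hlog1 : 0 < Real.log (1 + bmin p ^ 2) := Real.log_pos (by linarith [sq_pos_of_pos hb0])
    have hlog2 : 0 < Real.log (1 + k p * bmin p ^ 2) :=
      Real.log_pos (by linarith [mul_pos hk0 (sq_pos_of_pos hb0)])
    have hmax : ∀ a, a ≤ max (Real.log ((p : ℝ) - k p) / Real.log (1 + bmin p ^ 2))
        (max ((k p : ℝ) * Real.log ((p : ℝ) / k p) / Real.log (1 + k p * bmin p ^ 2))
          (k p : ℝ)) → 4000 * a ≤ n p := fun a ha =>
      (mul_le_mul_of_nonneg_left ha (by norm_num)).trans hnp.le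
    have h1 := hmax _ (le_max_left _ _)
    have h2 := hmax _ ((le_max_left _ _).trans (le_max_right _ _))
    have h3 := hmax _ ((le_max_right _ _).trans (le_max_right _ _))
    rw [← mul_div_assoc, div_le_iff₀ hlog1] at h1
    rw [← mul_div_assoc, div_le_iff₀ hlog2] at h2
    exact errP_le_inv_sq (hT p) (hsupp p) hb0 (fun i hi => hb.2 ⟨i, hi, rfl⟩) hkp hp
      (by linarith) h1 h2
  have hfin : ∀ p, errP (n p) (k p) (β p) (T p) ≠ ⊤ := fun p => measure_ne_top _ _
  have hsq : Summable fun p : ℕ => ((p : ℝ) ^ 2)⁻¹ := Real.summable_nat_pow_inv.2 (by norm_num)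
  have hsum : Summable fun p => (errP (n p) (k p) (β p) (T p)).toReal := by
    refine summable_of_isBigO_nat hsq (Asymptotics.IsBigO.of_bound 1 ?_)
    filter_upwards [hbound] with p hp
    rw [one_mul, Real.norm_of_nonneg ENNReal.toReal_nonneg, Real.norm_of_nonneg (by positivity)]
    exact ENNReal.toReal_le_of_le_ofReal (by positivity) hp
  refine ⟨hsum, ?_, ?_⟩
  · have h := ENNReal.tendsto_ofReal hsum.tendsto_atTop_zero
    simpa [ENNReal.ofReal_toReal (hfin _)] using h
  · intro Ω _ P _ A hA
    refine ae_eventually_notMem ?_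
    simp_rw [hA]
    have h := hsum.tsum_ofReal_ne_top
    simpa [ENNReal.ofReal_toReal (hfin _)] using h

end
end
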